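/- arXiv:math/0304398 — 2 statements merged into one kernel-verified Lean document; each statement's English description precedes it below -/
import Mathlib

section
/- Let u : ℝ² → ℝ be a C⁴ function defined on all of ℝ² whose Hessian D²u(x) is positive definite at every point, and suppose u satisfies the affine maximal surface equation L[u] = 0 on ℝ². Then u is a quadratic polynomial, i.e. there exist a positive definite symmetric 2×2 matrix A, a vector b ∈ ℝ² and c ∈ ℝ with u(x) = ½⟨Ax, x⟩ + ⟨b, x⟩ + c for all x. -/
open MeasureTheory

noncomputable section

/-- `ℝⁿ` with the Euclidean structure. -/
abbrev E (n : ℕ) := EuclideanSpace ℝ (Fin n)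

/-- The Hessian matrix `D²u(x)` of second partial derivatives. -/
noncomputable def Hess {n : ℕ} (u : E n → ℝ) (x : E n) : Matrix (Fin n) (Fin n) ℝ :=
  fun i j => iteratedFDeriv ℝ 2 u x ![EuclideanSpace.single i 1, EuclideanSpace.single j 1]

/-- `w(x) = (det D²u(x))^(-(n+1)/(n+2))`. -/
noncomputable def wFn (n : ℕ) (u : E n → ℝ) (x : E n) : ℝ :=
  (Hess u x).det ^ (-(n + 1 : ℝ) / (n + 2))

/-- The affine maximal surface operator `L[u](x) = ∑ᵢⱼ Uⁱʲ(x) ∂²w/∂xᵢ∂xⱼ(x)`,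
where `[Uⁱʲ]` is the cofactor (= adjugate, by symmetry of the Hessian) matrix of `D²u`. -/
noncomputable def Lop (n : ℕ) (u : E n → ℝ) (x : E n) : ℝ :=
  ∑ i, ∑ j, (Hess u x).adjugate i j *
    iteratedFDeriv ℝ 2 (wFn n u) x ![EuclideanSpace.single i 1, EuclideanSpace.single j 1]

/-- The linear form on the plane with coefficients `g`. -/
def lin (g : Fin 2 → ℝ) : E 2 →L[ℝ] ℝ :=
  g 0 • EuclideanSpace.proj 0 + g 1 • EuclideanSpace.proj 1

theorem lin_apply (g : Fin 2 → ℝ) (v : E 2) : lin g v = g 0 * v 0 + g 1 * v 1 := by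
  simp [lin]

theorem lin_eq {g : Fin 2 → ℝ} {L : E 2 →L[ℝ] ℝ} (h0 : L (EuclideanSpace.single 0 1) = g 0)
    (h1 : L (EuclideanSpace.single 1 1) = g 1) : L = lin g := by
  ext v
  have hv : v = v 0 • EuclideanSpace.single 0 1 + v 1 • EuclideanSpace.single 1 1 := by
    ext i; fin_cases i <;> simp
  rw [lin_apply]
  conv_lhs => rw [hv]
  rw [map_add, map_smul, map_smul, h0, h1]
  simp only [smul_eq_mul]; ring

/-- `f` is differentiable at `x` with gradient `g`. -/
def Grad (f : E 2 → ℝ) (x : E 2) (g : Fin 2 → ℝ) : Prop := HasFDerivAt f (lin g) x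

namespace Grad

variable {f f₁ f₂ : E 2 → ℝ} {x : E 2} {g g₁ g₂ : Fin 2 → ℝ}

theorem congr (h : Grad f x g₁) (h0 : g₁ 0 = g₂ 0) (h1 : g₁ 1 = g₂ 1) : Grad f x g₂ := by
  have : g₁ = g₂ := by ext i; fin_cases i <;> assumption
  exact this ▸ h

theorem const (c : ℝ) (x : E 2) : Grad (fun _ => c) x (fun _ => 0) := by
  have : lin (fun _ => 0) = 0 := by simp [lin]
  rw [Grad, this]; exact hasFDerivAt_const c x

theorem coord (x : E 2) (k : Fin 2) : Grad (fun y => y k) x (fun i => if k = i then 1 else 0) := by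
  have h : lin (fun i => if k = i then 1 else 0) = EuclideanSpace.proj k := by
    symm; apply lin_eq <;> fin_cases k <;> simp
  rw [Grad, h]
  exact (EuclideanSpace.proj k : E 2 →L[ℝ] ℝ).hasFDerivAt

theorem add (h₁ : Grad f₁ x g₁) (h₂ : Grad f₂ x g₂) :
    Grad (fun y => f₁ y + f₂ y) x (fun i => g₁ i + g₂ i) := by
  have h : lin (fun i => g₁ i + g₂ i) = lin g₁ + lin g₂ := by
    ext v; simp only [_root_.add_apply, lin_apply]; ring
  rw [Grad, h]; exact HasFDerivAt.fun_add h₁ h₂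

theorem mul (h₁ : Grad f₁ x g₁) (h₂ : Grad f₂ x g₂) :
    Grad (fun y => f₁ y * f₂ y) x (fun i => f₁ x * g₂ i + g₁ i * f₂ x) := by
  have h : lin (fun i => f₁ x * g₂ i + g₁ i * f₂ x) = f₁ x • lin g₂ + f₂ x • lin g₁ := by
    ext v
    simp only [_root_.add_apply, _root_.smul_apply, smul_eq_mul,
      lin_apply]
    ring
  rw [Grad, h]; exact HasFDerivAt.fun_mul h₁ h₂

theorem const_mul (c : ℝ) (h : Grad f x g) : Grad (fun y => c * f y) x (fun i => c * g i) :=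
  ((const c x).mul h).congr (by simp) (by simp)

theorem neg (h : Grad f x g) : Grad (fun y => -f y) x (fun i => -g i) := by
  have e : (fun y => -f y) = fun y => (-1) * f y := by ext; ring
  rw [e]
  exact (h.const_mul (-1)).congr (by ring) (by ring)

theorem sub (h₁ : Grad f₁ x g₁) (h₂ : Grad f₂ x g₂) :
    Grad (fun y => f₁ y - f₂ y) x (fun i => g₁ i - g₂ i) := by
  simpa only [sub_eq_add_neg] using h₁.add h₂.neg

theorem comp {F : ℝ → ℝ} {F' : ℝ} (h : Grad f x g) (hF : HasDerivAt F F' (f x)) :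
    Grad (fun y => F (f y)) x (fun i => F' * g i) := by
  have e : lin (fun i => F' * g i) = F' • lin g := by
    ext v; simp only [_root_.smul_apply, smul_eq_mul, lin_apply]; ring
  rw [Grad, e]; exact hF.comp_hasFDerivAt x h

theorem continuousAt (h : Grad f x g) : ContinuousAt f x := HasFDerivAt.continuousAt h

theorem line {v : E 2} {s : ℝ} (h : Grad f (x + s • v) g) :
    HasDerivAt (fun τ : ℝ => f (x + τ • v)) (g 0 * v 0 + g 1 * v 1) s := by
  have hl : HasDerivAt (fun τ : ℝ => x + τ • v) v s := by
    simpa using ((hasDerivAt_id s).smul_const v).const_add x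
  have h' : HasFDerivAt f (lin g) ((fun τ : ℝ => x + τ • v) s) := h
  have := h'.comp_hasDerivAt s hl
  rw [lin_apply] at this
  exact this

theorem eq_zero (h : Grad f x g) (hf : IsLocalMin f x) (i : Fin 2) : g i = 0 := by
  have h0 : lin g = 0 := hf.hasFDerivAt_eq_zero h
  have := congrArg (fun L => L (EuclideanSpace.single i 1)) h0
  fin_cases i <;> simpa [lin_apply] using this

theorem unique (h : Grad f x g₁) (h' : Grad f x g₂) (i : Fin 2) : g₁ i = g₂ i := by
  have := congrArg (fun L => L (EuclideanSpace.single i 1)) (HasFDerivAt.unique h h')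
  fin_cases i <;> simpa [lin_apply] using this

theorem is_const {f : E 2 → ℝ} (h : ∀ x, Grad f x fun _ => 0) (x y : E 2) :
    f x = f y := by
  refine is_const_of_fderiv_eq_zero (𝕜 := ℝ) (fun z => (h z).differentiableAt) (fun z => ?_) x y
  rw [(h z).fderiv]
  ext v
  simp [lin_apply]

end Grad

open Filter Topology in
/-- `f` is twice differentiable at `x` with gradient `g` and second derivatives `H`. -/
def Jet (f : E 2 → ℝ) (x : E 2) (g : Fin 2 → ℝ) (H : Fin 2 → Fin 2 → ℝ) : Prop :=
  ∃ G : E 2 → Fin 2 → ℝ, (∀ᶠ y in 𝓝 x, Grad f y (G y)) ∧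
    ∀ i, G x i = g i ∧ Grad (fun y => G y i) x (H i)

namespace Jet

open Filter Topology

variable {f f₁ f₂ : E 2 → ℝ} {x : E 2} {g g₁ g₂ : Fin 2 → ℝ} {H H₁ H₂ : Fin 2 → Fin 2 → ℝ}

theorem of_grad {G : E 2 → Fin 2 → ℝ} (h : ∀ y, Grad f y (G y))
    (hG : ∀ i, Grad (fun y => G y i) x (H i)) : Jet f x (G x) H :=
  ⟨G, Eventually.of_forall h, fun i => ⟨rfl, hG i⟩⟩

theorem grad (h : Jet f x g H) : Grad f x g := by
  obtain ⟨G, h, hG⟩ := h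
  exact h.self_of_nhds.congr (hG 0).1 (hG 1).1

theorem add (h₁ : Jet f₁ x g₁ H₁) (h₂ : Jet f₂ x g₂ H₂) :
    Jet (fun y => f₁ y + f₂ y) x (fun i => g₁ i + g₂ i) (fun i j => H₁ i j + H₂ i j) := by
  obtain ⟨G₁, h₁, hG₁⟩ := h₁
  obtain ⟨G₂, h₂, hG₂⟩ := h₂
  refine ⟨fun y i => G₁ y i + G₂ y i, ?_, fun i => ⟨?_, (hG₁ i).2.add (hG₂ i).2⟩⟩
  · filter_upwards [h₁, h₂] with y k₁ k₂ using k₁.add k₂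
  · simp only [(hG₁ i).1, (hG₂ i).1]

theorem const_mul (c : ℝ) (h : Jet f x g H) :
    Jet (fun y => c * f y) x (fun i => c * g i) (fun i j => c * H i j) := by
  obtain ⟨G, h, hG⟩ := h
  refine ⟨fun y i => c * G y i, ?_, fun i => ⟨?_, (hG i).2.const_mul c⟩⟩
  · filter_upwards [h] with y k using k.const_mul c
  · simp only [(hG i).1]

theorem const_sub (c : ℝ) (h : Jet f x g H) :
    Jet (fun y => c - f y) x (fun i => -g i) (fun i j => -H i j) := by
  obtain ⟨G, h, hG⟩ := h
  refine ⟨fun y i => -G y i, ?_, fun i => ⟨?_, (hG i).2.neg⟩⟩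
  · filter_upwards [h] with y k using ((Grad.const c y).sub k).congr (by simp) (by simp)
  · simp only [(hG i).1]

theorem add_const (c : ℝ) (h : Jet f x g H) :
    Jet (fun y => f y + c) x g H := by
  obtain ⟨G, h, hG⟩ := h
  refine ⟨G, ?_, hG⟩
  filter_upwards [h] with y k using (k.add (Grad.const c y)).congr (by simp) (by simp)

theorem comp {F F' : ℝ → ℝ} {F'' : ℝ} (h : Jet f x g H)
    (hF : ∀ᶠ s in 𝓝 (f x), HasDerivAt F (F' s) s) (hF' : HasDerivAt F' F'' (f x)) :
    Jet (fun y => F (f y)) x (fun i => F' (f x) * g i)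
      (fun i j => F' (f x) * H i j + F'' * g i * g j) := by
  have hf := h.grad
  obtain ⟨G, h, hG⟩ := h
  refine ⟨fun y i => F' (f y) * G y i, ?_, fun i => ⟨?_, ?_⟩⟩
  · filter_upwards [h, hf.continuousAt.eventually hF] with y k₁ k₂ using k₁.comp k₂
  · simp only [(hG i).1]
  · refine ((hf.comp hF').mul (hG i).2).congr ?_ ?_ <;> (simp only [(hG i).1]; ring)

theorem log (h : Jet f x g H) (hf : 0 < f x) :
    Jet (fun y => Real.log (f y)) x (fun i => g i / f x)
      (fun i j => H i j / f x - g i * g j / f x ^ 2) := by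
  have hF : ∀ᶠ s in 𝓝 (f x), HasDerivAt Real.log s⁻¹ s := by
    filter_upwards [lt_mem_nhds hf] with s hs using Real.hasDerivAt_log hs.ne'
  convert h.comp hF (hasDerivAt_inv hf.ne') using 3 <;> ring

theorem exp (h : Jet f x g H) :
    Jet (fun y => Real.exp (f y)) x (fun i => Real.exp (f x) * g i)
      (fun i j => Real.exp (f x) * (H i j + g i * g j)) := by
  convert h.comp (Eventually.of_forall fun s => Real.hasDerivAt_exp s)
    (Real.hasDerivAt_exp (f x)) using 3
  ring

theorem sqrt (h : Jet f x g H) (hf : 0 < f x) :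
    Jet (fun y => √(f y)) x (fun i => g i / (2 * √(f x)))
      (fun i j => H i j / (2 * √(f x)) - g i * g j / (4 * √(f x) ^ 3)) := by
  have hF : ∀ᶠ s in 𝓝 (f x), HasDerivAt (fun s => √s) (1 / (2 * √s)) s := by
    filter_upwards [lt_mem_nhds hf] with s hs using Real.hasDerivAt_sqrt hs.ne'
  have hR : 0 < √(f x) := Real.sqrt_pos.2 hf
  have hF' : HasDerivAt (fun s => 1 / (2 * √s)) (-(1 / (4 * √(f x) ^ 3))) (f x) := by
    have := (hF.self_of_nhds.const_mul 2).inv (by positivity)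
    have e : -(1 / (4 * √(f x) ^ 3)) = -(2 * (1 / (2 * √(f x)))) / (2 * √(f x)) ^ 2 := by
      field_simp; norm_num
    rw [e]
    simp only [one_div] at this ⊢
    exact this
  convert h.comp hF hF' using 3 <;> ring

theorem nonneg (h : Jet f x g H) (hf : IsLocalMin f x) (v₀ v₁ : ℝ) :
    0 ≤ H 0 0 * v₀ ^ 2 + (H 0 1 + H 1 0) * v₀ * v₁ + H 1 1 * v₁ ^ 2 := by
  by_contra! hneg
  have hgz := h.grad.eq_zero hf
  obtain ⟨G, h, hG⟩ := h
  set v : E 2 := !₂[v₀, v₁] with hv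
  set φ : ℝ → ℝ := fun s => f (x + s • v) with hφ
  have hv0 : v 0 = v₀ := by simp [hv]
  have hv1 : v 1 = v₁ := by simp [hv]
  have hc : Tendsto (fun s : ℝ => x + s • v) (𝓝 0) (𝓝 x) := by
    have : Continuous fun s : ℝ => x + s • v := by fun_prop
    simpa using this.tendsto 0
  have hd : ∀ᶠ s in 𝓝 (0 : ℝ),
      HasDerivAt φ (G (x + s • v) 0 * v₀ + G (x + s • v) 1 * v₁) s := by
    filter_upwards [hc.eventually h] with s hs
    simpa only [hv0, hv1] using hs.line
  have hd' : deriv φ =ᶠ[𝓝 0] fun s => G (x + s • v) 0 * v₀ + G (x + s • v) 1 * v₁ :=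
    hd.mono fun s hs => hs.deriv
  have hl : ∀ i, HasDerivAt (fun s : ℝ => G (x + s • v) i) (H i 0 * v₀ + H i 1 * v₁) 0 := by
    intro i
    have := (hG i).2
    rw [show x = x + (0 : ℝ) • v by simp] at this
    simpa only [hv0, hv1] using this.line
  have hdd : deriv (deriv φ) 0 =
      (H 0 0 * v₀ + H 0 1 * v₁) * v₀ + (H 1 0 * v₀ + H 1 1 * v₁) * v₁ := by
    rw [hd'.deriv_eq]
    exact (((hl 0).mul_const v₀).add ((hl 1).mul_const v₁)).deriv
  have hdd' : deriv (deriv φ) 0 < 0 := by rw [hdd]; nlinarith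
  have hd0 : deriv φ 0 = 0 := by
    rw [hd'.self_of_nhds]
    simp [(hG 0).1, (hG 1).1, hgz]
  have hmax : IsLocalMax φ 0 :=
    isLocalMax_of_deriv_deriv_neg hdd' hd0 hd.self_of_nhds.continuousAt
  have hmin : ∀ᶠ s in 𝓝 (0 : ℝ), φ 0 ≤ φ s := by
    filter_upwards [hc.eventually hf] with s hs
    simpa [hφ] using hs
  have hconst : φ =ᶠ[𝓝 0] fun _ => φ 0 := by
    filter_upwards [hmax, hmin] with s h₁ h₂ using le_antisymm h₁ h₂
  have : deriv (deriv φ) 0 = 0 := by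
    rw [hconst.deriv.deriv_eq]; simp
  linarith

end Jet

/-- The bilinear form of the cofactor matrix of a symmetric `2 × 2` matrix. -/
def bil (a : Fin 2 → Fin 2 → ℝ) (g k : Fin 2 → ℝ) : ℝ :=
  a 1 1 * (g 0 * k 0) - a 0 1 * (g 0 * k 1 + g 1 * k 0) + a 0 0 * (g 1 * k 1)

/-- The contraction of `H` with the cofactor matrix of a symmetric `2 × 2` matrix. -/
def lam (a H : Fin 2 → Fin 2 → ℝ) : ℝ :=
  a 1 1 * H 0 0 - a 0 1 * (H 0 1 + H 1 0) + a 0 0 * H 1 1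

theorem bil_self_nonneg {a : Fin 2 → Fin 2 → ℝ} (ha : 0 < a 0 0)
    (hd : 0 < a 0 0 * a 1 1 - a 0 1 ^ 2) (g : Fin 2 → ℝ) : 0 ≤ bil a g g := by
  have h : a 0 0 * bil a g g =
      (a 0 0 * g 1 - a 0 1 * g 0) ^ 2 + (a 0 0 * a 1 1 - a 0 1 ^ 2) * g 0 ^ 2 := by
    unfold bil; ring
  have : 0 ≤ a 0 0 * bil a g g := by rw [h]; positivity
  exact nonneg_of_mul_nonneg_right this ha

theorem bil_self_eq_zero {a : Fin 2 → Fin 2 → ℝ} (ha : 0 < a 0 0)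
    (hd : 0 < a 0 0 * a 1 1 - a 0 1 ^ 2) {g : Fin 2 → ℝ} (h : bil a g g ≤ 0) (i : Fin 2) :
    g i = 0 := by
  have h' : a 0 0 * bil a g g =
      (a 0 0 * g 1 - a 0 1 * g 0) ^ 2 + (a 0 0 * a 1 1 - a 0 1 ^ 2) * g 0 ^ 2 := by
    unfold bil; ring
  have h1 : a 0 0 * bil a g g ≤ 0 := mul_nonpos_of_nonneg_of_nonpos ha.le h
  have h0 : g 0 = 0 := by
    by_contra hg
    have : 0 < (a 0 0 * a 1 1 - a 0 1 ^ 2) * g 0 ^ 2 := by positivity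
    nlinarith [sq_nonneg (a 0 0 * g 1 - a 0 1 * g 0)]
  rw [h', h0] at h1
  have h2 : a 0 0 * g 1 = 0 := by
    have : (a 0 0 * g 1) ^ 2 ≤ 0 := by linarith
    exact pow_eq_zero_iff two_ne_zero |>.1 (le_antisymm this (sq_nonneg _))
  have h3 : g 1 = 0 := (mul_eq_zero.1 h2).resolve_left ha.ne'
  fin_cases i <;> assumption

theorem Jet.lam_nonneg {f : E 2 → ℝ} {x : E 2} {g : Fin 2 → ℝ} {H a : Fin 2 → Fin 2 → ℝ}
    (h : Jet f x g H) (hf : IsLocalMin f x) (ha : 0 < a 0 0)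
    (hd : 0 < a 0 0 * a 1 1 - a 0 1 ^ 2) : 0 ≤ lam a H := by
  have h1 := h.nonneg hf (-a 0 1) (a 0 0)
  have h2 := h.nonneg hf 1 0
  have e : a 0 0 * lam a H =
      (H 0 0 * (-a 0 1) ^ 2 + (H 0 1 + H 1 0) * (-a 0 1) * a 0 0 + H 1 1 * a 0 0 ^ 2) +
      (a 0 0 * a 1 1 - a 0 1 ^ 2) *
        (H 0 0 * 1 ^ 2 + (H 0 1 + H 1 0) * 1 * 0 + H 1 1 * 0 ^ 2) := by
    unfold lam; ring
  have : 0 ≤ a 0 0 * lam a H := by rw [e]; exact add_nonneg h1 (mul_nonneg hd.le h2)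
  exact nonneg_of_mul_nonneg_right this ha

/-- An entire locally uniformly convex solution of the affine maximal surface equation in the
plane, together with its derivatives; `t` is `-1/4` times the logarithm of the determinant of
the Hessian, in terms of which the equation reads `lam a (D²t) = -3 bil a (∇t) (∇t)`. -/
structure Sol where
  u : E 2 → ℝ
  p : E 2 → Fin 2 → ℝ
  a : E 2 → Fin 2 → Fin 2 → ℝ
  c : E 2 → Fin 2 → Fin 2 → Fin 2 → ℝ
  d : E 2 → Fin 2 → Fin 2 → Fin 2 → Fin 2 → ℝ
  t : E 2 → ℝ
  s : E 2 → Fin 2 → ℝ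
  h : E 2 → Fin 2 → Fin 2 → ℝ
  grad_u : ∀ x, Grad u x (p x)
  grad_p : ∀ x i, Grad (fun y => p y i) x (a x i)
  grad_a : ∀ x i j, Grad (fun y => a y i j) x (c x i j)
  grad_c : ∀ x i j k, Grad (fun y => c y i j k) x (d x i j k)
  grad_t : ∀ x, Grad t x (s x)
  grad_s : ∀ x i, Grad (fun y => s y i) x (h x i)
  a_symm : ∀ x, a x 1 0 = a x 0 1
  c_symm : ∀ x i j k, c x i j k = c x i k j
  d_symm : ∀ x i j k l, d x i j k l = d x i j l k
  a_pos : ∀ x, 0 < a x 0 0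
  det_eq : ∀ x, a x 0 0 * a x 1 1 - a x 0 1 ^ 2 = Real.exp (-4 * t x)
  pde : ∀ x, lam (a x) (h x) = -3 * bil (a x) (s x) (s x)

namespace Sol

variable (S : Sol)

theorem det_pos (x : E 2) : 0 < S.a x 0 0 * S.a x 1 1 - S.a x 0 1 ^ 2 := by
  rw [S.det_eq]; exact Real.exp_pos _

theorem c_symm_left (x : E 2) (k : Fin 2) : S.c x 1 0 k = S.c x 0 1 k := by
  have h : (fun y => S.a y 1 0) = fun y => S.a y 0 1 := funext S.a_symm
  have h1 := S.grad_a x 1 0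
  rw [h] at h1
  exact h1.unique (S.grad_a x 0 1) k

/-- The first derivatives of the determinant of the Hessian. -/
theorem det_deriv (x : E 2) (k : Fin 2) :
    S.a x 1 1 * S.c x 0 0 k + S.a x 0 0 * S.c x 1 1 k - 2 * S.a x 0 1 * S.c x 0 1 k =
      -4 * S.s x k * (S.a x 0 0 * S.a x 1 1 - S.a x 0 1 ^ 2) := by
  have h1 := ((S.grad_a x 0 0).mul (S.grad_a x 1 1)).sub ((S.grad_a x 0 1).mul (S.grad_a x 0 1))
  have h2 := ((S.grad_t x).const_mul (-4)).comp (Real.hasDerivAt_exp _)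
  have e : (fun y => S.a y 0 0 * S.a y 1 1 - S.a y 0 1 * S.a y 0 1) =
      fun y => Real.exp (-4 * S.t y) := by
    funext y; rw [← S.det_eq]; ring
  rw [e] at h1
  have := h1.unique h2 k
  rw [← S.det_eq] at this
  linarith

/-- The solution obtained by subtracting the first-order Taylor polynomial at `x₀`. -/
def tilt (x₀ : E 2) : Sol :=
  { S with
    u := fun x => S.u x - (S.u x₀ + (S.p x₀ 0 * (x 0 - x₀ 0) + S.p x₀ 1 * (x 1 - x₀ 1)))
    p := fun x i => S.p x i - S.p x₀ i
    grad_u := fun x =>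
      ((S.grad_u x).sub ((Grad.const (S.u x₀) x).add
        ((((Grad.coord x 0).sub (Grad.const (x₀ 0) x)).const_mul (S.p x₀ 0)).add
        (((Grad.coord x 1).sub (Grad.const (x₀ 1) x)).const_mul (S.p x₀ 1))))).congr
        (by simp) (by simp)
    grad_p := fun x i =>
      ((S.grad_p x i).sub (Grad.const (S.p x₀ i) x)).congr (by simp) (by simp) }

theorem continuous_u : Continuous S.u :=
  continuous_iff_continuousAt.2 fun x => (S.grad_u x).continuousAt

theorem continuous_p (i : Fin 2) : Continuous fun x => S.p x i :=
  continuous_iff_continuousAt.2 fun x => (S.grad_p x i).continuousAt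

theorem continuous_t : Continuous S.t :=
  continuous_iff_continuousAt.2 fun x => (S.grad_t x).continuousAt

theorem strictMono_line (x : E 2) {v : E 2} (hv : v ≠ 0) :
    StrictMono fun τ : ℝ => S.p (x + τ • v) 0 * v 0 + S.p (x + τ • v) 1 * v 1 := by
  refine strictMono_of_deriv_pos fun τ => ?_
  have h := ((S.grad_p (x + τ • v) 0).line.mul_const (v 0)).fun_add
    ((S.grad_p (x + τ • v) 1).line.mul_const (v 1))
  rw [HasDerivAt.deriv h]
  have ha := S.a_pos (x + τ • v)
  have hd := S.det_pos (x + τ • v)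
  have hs := S.a_symm (x + τ • v)
  set A := S.a (x + τ • v)
  rw [hs]
  have e : A 0 0 * ((A 0 0 * v 0 + A 0 1 * v 1) * v 0 + (A 0 1 * v 0 + A 1 1 * v 1) * v 1) =
      (A 0 0 * v 0 + A 0 1 * v 1) ^ 2 + (A 0 0 * A 1 1 - A 0 1 ^ 2) * v 1 ^ 2 := by ring
  refine (mul_pos_iff_of_pos_left ha).1 ?_
  rw [e]
  by_cases h1 : v 1 = 0
  · have h0 : v 0 ≠ 0 := by
      intro h0; apply hv; ext i; fin_cases i <;> simpa
    rw [h1]; simp only [mul_zero, add_zero, ne_eq, OfNat.ofNat_ne_zero, not_false_eq_true,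
      zero_pow]
    positivity
  · positivity

theorem monotone_grad {x z : E 2} (h : x ≠ z) :
    S.p x 0 * (z 0 - x 0) + S.p x 1 * (z 1 - x 1) <
      S.p z 0 * (z 0 - x 0) + S.p z 1 * (z 1 - x 1) := by
  have := S.strictMono_line x (sub_ne_zero.2 h.symm) zero_lt_one
  simpa using this

theorem gradient_inequality {x z : E 2} (h : x ≠ z) :
    S.u x + (S.p x 0 * (z 0 - x 0) + S.p x 1 * (z 1 - x 1)) < S.u z := by
  set v := z - x with hv
  obtain ⟨ξ, hξ, he⟩ := exists_hasDerivAt_eq_slope (fun τ : ℝ => S.u (x + τ • v))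
    (fun τ => S.p (x + τ • v) 0 * v 0 + S.p (x + τ • v) 1 * v 1) zero_lt_one
    (by have := S.continuous_u; fun_prop) (fun τ _ => (S.grad_u (x + τ • v)).line)
  have := S.strictMono_line x (sub_ne_zero.2 h.symm) hξ.1
  simp only [← hv] at this
  rw [he] at this
  simp [hv] at this
  linarith

theorem gradient_inequality_le (x z : E 2) :
    S.u x + (S.p x 0 * (z 0 - x 0) + S.p x 1 * (z 1 - x 1)) ≤ S.u z := by
  rcases eq_or_ne x z with rfl | h
  · simp
  · exact (S.gradient_inequality h).le

/-- The Legendre transform of `u` with respect to `x₀`, as a function of `x`. -/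
def V (x₀ x : E 2) : ℝ := (x 0 - x₀ 0) * S.p x 0 + (x 1 - x₀ 1) * S.p x 1 - S.u x

/-- The gradient of the Legendre transform. -/
def N (x₀ x : E 2) (i : Fin 2) : ℝ := S.a x i 0 * (x 0 - x₀ 0) + S.a x i 1 * (x 1 - x₀ 1)

theorem grad_V (x₀ x : E 2) : Grad (S.V x₀) x (S.N x₀ x) := by
  refine (((((Grad.coord x 0).sub (Grad.const (x₀ 0) x)).mul (S.grad_p x 0)).add
    (((Grad.coord x 1).sub (Grad.const (x₀ 1) x)).mul (S.grad_p x 1))).sub (S.grad_u x)).congr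
      ?_ ?_ <;> simp [N, S.a_symm] <;> ring

theorem grad_N (x₀ x : E 2) (i : Fin 2) : Grad (fun y => S.N x₀ y i) x
    (fun j => S.a x i j + (S.c x i 0 j * (x 0 - x₀ 0) + S.c x i 1 j * (x 1 - x₀ 1))) := by
  refine (((S.grad_a x i 0).mul ((Grad.coord x 0).sub (Grad.const (x₀ 0) x))).add
    ((S.grad_a x i 1).mul ((Grad.coord x 1).sub (Grad.const (x₀ 1) x)))).congr
      ?_ ?_ <;> simp <;> ring

theorem continuous_V (x₀ : E 2) : Continuous (S.V x₀) :=
  continuous_iff_continuousAt.2 fun x => (S.grad_V x₀ x).continuousAt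

theorem jet_u (x : E 2) : Jet S.u x (S.p x) (S.a x) := Jet.of_grad S.grad_u (S.grad_p x)

theorem jet_t (x : E 2) : Jet S.t x (S.s x) (S.h x) := Jet.of_grad S.grad_t (S.grad_s x)

theorem jet_V (x₀ x : E 2) : Jet (S.V x₀) x (S.N x₀ x) (fun i j =>
    S.a x i j + (S.c x i 0 j * (x 0 - x₀ 0) + S.c x i 1 j * (x 1 - x₀ 1))) :=
  Jet.of_grad (S.grad_V x₀) (S.grad_N x₀ x)

theorem lam_a (x : E 2) :
    lam (S.a x) (S.a x) = 2 * (S.a x 0 0 * S.a x 1 1 - S.a x 0 1 ^ 2) := by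
  rw [lam, S.a_symm]; ring

theorem c_010 (x : E 2) : S.c x 0 1 0 = S.c x 0 0 1 := S.c_symm x 0 1 0

theorem c_110 (x : E 2) : S.c x 1 1 0 = S.c x 0 1 1 := by
  rw [S.c_symm, S.c_symm_left]

theorem lam_c (x : E 2) (k : Fin 2) : lam (S.a x) (S.c x k) =
    -4 * S.s x k * (S.a x 0 0 * S.a x 1 1 - S.a x 0 1 ^ 2) := by
  rw [← S.det_deriv x k, lam]
  fin_cases k <;> simp only [Fin.zero_eta, Fin.mk_one, S.c_symm_left, S.c_110, S.c_010] <;> ring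

theorem lam_V (x₀ x : E 2) : lam (S.a x) (fun i j =>
    S.a x i j + (S.c x i 0 j * (x 0 - x₀ 0) + S.c x i 1 j * (x 1 - x₀ 1))) =
    (2 - 4 * (S.s x 0 * (x 0 - x₀ 0) + S.s x 1 * (x 1 - x₀ 1))) *
      (S.a x 0 0 * S.a x 1 1 - S.a x 0 1 ^ 2) := by
  have h0 := S.lam_c x 0
  have h1 := S.lam_c x 1
  have h := S.lam_a x
  simp only [lam, S.c_symm_left, S.c_110, S.c_010] at h h0 h1 ⊢
  linear_combination h + (x 0 - x₀ 0) * h0 + (x 1 - x₀ 1) * h1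

end Sol

namespace Sol

variable (S : Sol) {x₀ : E 2}

/-- The tangent plane of the graph at `x₀` is horizontal, at height zero. -/
def Normalized (x₀ : E 2) : Prop := S.u x₀ = 0 ∧ ∀ i, S.p x₀ i = 0

theorem tilt_normalized (x₀ : E 2) : (S.tilt x₀).Normalized x₀ := by
  simp [Normalized, tilt]

variable {S}

theorem Normalized.u_pos (hS : S.Normalized x₀) {x : E 2} (hx : x ≠ x₀) : 0 < S.u x := by
  simpa [hS.1, hS.2] using S.gradient_inequality hx.symm

theorem Normalized.V_pos (hS : S.Normalized x₀) {x : E 2} (hx : x ≠ x₀) : 0 < S.V x₀ x := by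
  have := S.gradient_inequality hx
  rw [hS.1] at this
  unfold V; linarith

theorem Normalized.u_nonneg (hS : S.Normalized x₀) (x : E 2) : 0 ≤ S.u x := by
  rcases eq_or_ne x x₀ with rfl | h
  · exact hS.1.ge
  · exact (hS.u_pos h).le

theorem le_V (x z : E 2) :
    (z 0 - x₀ 0) * S.p x 0 + (z 1 - x₀ 1) * S.p x 1 - S.u z ≤ S.V x₀ x := by
  have := S.gradient_inequality_le x z
  unfold V; linarith

/-- Linear growth of `u` and a lower bound for its Legendre transform away from `x₀`. -/
theorem Normalized.exists_bound (hS : S.Normalized x₀) :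
    ∃ ε > 0, ∀ x, 1 ≤ ‖x - x₀‖ → ε * ‖x - x₀‖ ≤ S.u x ∧ ε ≤ S.V x₀ x := by
  have hne : (Metric.sphere x₀ 1).Nonempty := NormedSpace.sphere_nonempty.2 zero_le_one
  have hc := isCompact_sphere x₀ 1
  obtain ⟨e₁, he₁, h₁⟩ := hc.exists_isMinOn hne S.continuous_u.continuousOn
  obtain ⟨e₂, he₂, h₂⟩ := hc.exists_isMinOn hne (S.continuous_V x₀).continuousOn
  have hs : ∀ e ∈ Metric.sphere x₀ 1, e ≠ x₀ := by
    rintro e he rfl; simp at he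
  refine ⟨min (S.u e₁) (S.V x₀ e₂), lt_min (hS.u_pos (hs _ he₁)) (hS.V_pos (hs _ he₂)),
    fun x hx => ?_⟩
  set ρ := ‖x - x₀‖ with hρ
  have hρ0 : 0 < ρ := by linarith
  set e : E 2 := x₀ + ρ⁻¹ • (x - x₀) with he
  have hes : e ∈ Metric.sphere x₀ 1 := by
    simp [he, norm_smul, ← hρ, abs_of_pos hρ0, inv_mul_cancel₀ hρ0.ne']
  have hei : ∀ i, e i = x₀ i + ρ⁻¹ * (x i - x₀ i) := fun i => by simp [he]
  have hu : ρ * S.u e ≤ S.u x := by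
    have k1 := S.gradient_inequality_le e x
    have k2 := S.gradient_inequality_le e x₀
    rw [hS.1] at k2
    set q := S.p e 0 * (x 0 - x₀ 0) + S.p e 1 * (x 1 - x₀ 1) with hq
    have e1 : S.p e 0 * (x 0 - e 0) + S.p e 1 * (x 1 - e 1) = (1 - ρ⁻¹) * q := by
      rw [hei, hei]; ring
    have e2 : S.p e 0 * (x₀ 0 - e 0) + S.p e 1 * (x₀ 1 - e 1) = -ρ⁻¹ * q := by
      rw [hei, hei]; ring
    rw [e1] at k1
    rw [e2] at k2
    have e3 : ρ * ρ⁻¹ = 1 := mul_inv_cancel₀ hρ0.ne'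
    have k3 := mul_le_mul_of_nonneg_left k2 (by linarith : 0 ≤ ρ - 1)
    have e4 : (ρ - 1) * (S.u e + -ρ⁻¹ * q) =
        ρ * S.u e - S.u e - (ρ * ρ⁻¹) * q + ρ⁻¹ * q := by ring
    rw [e4, e3] at k3
    linarith
  have hV : S.V x₀ e ≤ S.V x₀ x := by
    refine le_trans ?_ (le_V x e)
    unfold V
    rcases eq_or_ne e x with h | h
    · rw [h]
    · have k := S.monotone_grad h
      have hcoef : ∀ i, x i - e i = (ρ - 1) * (e i - x₀ i) := fun i => by
        rw [hei]; field_simp; ring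
      rw [hcoef, hcoef] at k
      have hρ1 : 0 ≤ ρ - 1 := by linarith
      have : 0 < (ρ - 1) * ((e 0 - x₀ 0) * S.p x 0 + (e 1 - x₀ 1) * S.p x 1 -
          ((e 0 - x₀ 0) * S.p e 0 + (e 1 - x₀ 1) * S.p e 1)) := by linarith
      have := pos_of_mul_pos_right this hρ1
      linarith
  constructor
  · calc _ ≤ S.u e₁ * ρ := by gcongr; exact min_le_left _ _
      _ ≤ S.u e * ρ := by gcongr; exact h₁ hes
      _ ≤ _ := by linarith
  · exact (min_le_right _ _).trans ((h₂ hes).trans hV)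

/-- The quantity `√(1 + |∇u|²)`. -/
def R (S : Sol) (x : E 2) : ℝ := √(S.p x 0 * S.p x 0 + S.p x 1 * S.p x 1 + 1)

theorem R_sq (S : Sol) (x : E 2) : S.R x ^ 2 = S.p x 0 * S.p x 0 + S.p x 1 * S.p x 1 + 1 :=
  Real.sq_sqrt (by nlinarith [mul_self_nonneg (S.p x 0), mul_self_nonneg (S.p x 1)])

theorem one_le_R (S : Sol) (x : E 2) : 1 ≤ S.R x := by
  rw [R, Real.one_le_sqrt]
  nlinarith [mul_self_nonneg (S.p x 0), mul_self_nonneg (S.p x 1)]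

theorem continuous_R (S : Sol) : Continuous S.R := by
  have h0 := S.continuous_p 0
  have h1 := S.continuous_p 1
  unfold R; fun_prop

theorem Normalized.exists_R_le (hS : S.Normalized x₀) :
    ∃ C, 0 < C ∧ ∀ x, S.R x ≤ S.V x₀ x + C := by
  obtain ⟨e, he, hM⟩ := (isCompact_closedBall x₀ 1).exists_isMaxOn
    ⟨x₀, Metric.mem_closedBall_self zero_le_one⟩ S.continuous_u.continuousOn
  refine ⟨1 + S.u e, by linarith [hS.u_nonneg e], fun x => ?_⟩
  have h1 := S.one_le_R x
  have h2 := S.R_sq x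
  have hR : S.R x ≠ 0 := by linarith
  set z : E 2 := !₂[x₀ 0 + S.p x 0 / S.R x, x₀ 1 + S.p x 1 / S.R x] with hz
  have hz0 : z 0 - x₀ 0 = S.p x 0 / S.R x := by simp [hz]
  have hz1 : z 1 - x₀ 1 = S.p x 1 / S.R x := by simp [hz]
  have hzm : z ∈ Metric.closedBall x₀ 1 := by
    rw [mem_closedBall_iff_norm, ← abs_of_nonneg (norm_nonneg _), ← sq_le_one_iff_abs_le_one,
      EuclideanSpace.real_norm_sq_eq, Fin.sum_univ_two]
    simp only [PiLp.sub_apply, hz0, hz1]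
    rw [div_pow, div_pow, ← add_div, div_le_one (by positivity)]
    linarith
  have h3 := le_V (S := S) (x₀ := x₀) x z
  have h4 : S.u z ≤ S.u e := hM hzm
  rw [hz0, hz1] at h3
  have h5 : S.p x 0 / S.R x * S.p x 0 + S.p x 1 / S.R x * S.p x 1 = S.R x - 1 / S.R x := by
    field_simp; linarith
  have h6 : 1 / S.R x ≤ 1 := by rw [div_le_one (by linarith)]; exact h1
  linarith

end Sol

/-- An arithmetic-geometric mean inequality for a pair of positive `2 × 2` matrices. -/
theorem four_mul_det_mul_det_le {A b c A' b' c' : ℝ} (hA : 0 < A) (hc' : 0 < c')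
    (hd : 0 < A * c - b ^ 2) (hd' : 0 < A' * c' - b' ^ 2) :
    0 < A * A' + 2 * b * b' + c * c' ∧
      4 * (A * c - b ^ 2) * (A' * c' - b' ^ 2) ≤ (A * A' + 2 * b * b' + c * c') ^ 2 := by
  set X := A * A' + 2 * b * b' + c * c' with hX
  set D := A * c - b ^ 2 with hD
  set D' := A' * c' - b' ^ 2 with hD'
  have e : X * (A * c') = (b * c' + A * b') ^ 2 + (D' * A ^ 2 + D * c' ^ 2) := by
    rw [hX, hD, hD']; ring
  have hK : 0 < D' * A ^ 2 + D * c' ^ 2 := by positivity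
  have hle : D' * A ^ 2 + D * c' ^ 2 ≤ X * (A * c') := by
    rw [e]; linarith [sq_nonneg (b * c' + A * b')]
  refine ⟨pos_of_mul_pos_left (hK.trans_le hle) (by positivity), ?_⟩
  have h1 : (D' * A ^ 2 + D * c' ^ 2) ^ 2 ≤ (X * (A * c')) ^ 2 :=
    pow_le_pow_left₀ hK.le hle 2
  have h2 : 4 * D * D' * (A * c') ^ 2 ≤ X ^ 2 * (A * c') ^ 2 := by
    nlinarith [sq_nonneg (D' * A ^ 2 - D * c' ^ 2)]
  exact le_of_mul_le_mul_right h2 (by positivity)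

theorem bil_comb_expansion {A b c P₀ P₁ y₀ y₁ s₀ s₁ m₀ m₁ σ μ ρ : ℝ}
    (hm₀ : m₀ = A * y₀ + b * y₁ - (A * P₀ + b * P₁) * ρ / 2)
    (hm₁ : m₁ = b * y₀ + c * y₁ - (b * P₀ + c * P₁) * ρ / 2)
    (hs₀ : s₀ = -(P₀ * σ) - m₀ * μ) (hs₁ : s₁ = -(P₁ * σ) - m₁ * μ) :
    -3 * (c * (s₀ * s₀) - b * (s₀ * s₁ + s₁ * s₀) + A * (s₁ * s₁)) +
      (2 * (A * c - b ^ 2) * σ +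
        (c * (P₀ * P₀) - b * (P₀ * P₁ + P₁ * P₀) + A * (P₁ * P₁)) * σ ^ 2) +
      (((2 - 4 * (s₀ * y₀ + s₁ * y₁)) * (A * c - b ^ 2) -
        (A * c - b ^ 2) * ((A + c - 4 * (P₀ * s₀ + P₁ * s₁)) * ρ -
          (A * P₀ ^ 2 + 2 * b * P₀ * P₁ + c * P₁ ^ 2) * ρ ^ 3) / 2) * μ -
        (c * (m₀ * m₀) - b * (m₀ * m₁ + m₁ * m₀) + A * (m₁ * m₁)) * μ ^ 2) =
    (A * c - b ^ 2) * (2 * σ + 2 * μ -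
      2 * (P₀ * y₀ + P₁ * y₁ - (P₀ ^ 2 + P₁ ^ 2) * ρ / 2) * σ * μ -
      ((A + c) * ρ - (A * P₀ ^ 2 + 2 * b * P₀ * P₁ + c * P₁ ^ 2) * ρ ^ 3) * μ / 2) -
    2 * (c * (P₀ * P₀) - b * (P₀ * P₁ + P₁ * P₀) + A * (P₁ * P₁)) * σ ^ 2 := by
  rw [hs₀, hs₁, hm₀, hm₁]; ring

theorem det_le_of_comb_nonneg {A b c P₀ P₁ y₀ y₁ U R C T m : ℝ} (hA : 0 < A)
    (hD : 0 < A * c - b ^ 2) (hS : 0 < T - U) (hC : C ≤ T) (hm : 0 < m) (hR : 0 < R)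
    (hRsq : R ^ 2 = P₀ * P₀ + P₁ * P₁ + 1)
    (hmV : m = y₀ * P₀ + y₁ * P₁ - U + -(1 / 2) * R + C)
    (h₁ : 0 ≤ (A * c - b ^ 2) * (2 * (T - U)⁻¹ + 2 * m⁻¹ -
      2 * (P₀ * y₀ + P₁ * y₁ - (P₀ ^ 2 + P₁ ^ 2) * R⁻¹ / 2) * (T - U)⁻¹ * m⁻¹ -
      ((A + c) * R⁻¹ - (A * P₀ ^ 2 + 2 * b * P₀ * P₁ + c * P₁ ^ 2) * R⁻¹ ^ 3) * m⁻¹ / 2)) :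
    A * c - b ^ 2 ≤ (2 * R) ^ 4 := by
  have h₂ := nonneg_of_mul_nonneg_right h₁ hD
  have h₃ : 0 ≤ 2 * m + 2 * (T - U) - 2 * (P₀ * y₀ + P₁ * y₁ - (P₀ ^ 2 + P₁ ^ 2) * R⁻¹ / 2) -
      ((A + c) * R⁻¹ - (A * P₀ ^ 2 + 2 * b * P₀ * P₁ + c * P₁ ^ 2) * R⁻¹ ^ 3) * (T - U) / 2 := by
    have := mul_nonneg h₂ (mul_pos hS hm).le
    refine this.trans_eq ?_
    field_simp
  have h₄ : (P₀ ^ 2 + P₁ ^ 2) * R⁻¹ = R - R⁻¹ := by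
    field_simp; linarith
  rw [h₄] at h₃
  have hρ : 0 < R⁻¹ := by positivity
  set q := (A + c) * R⁻¹ - (A * P₀ ^ 2 + 2 * b * P₀ * P₁ + c * P₁ ^ 2) * R⁻¹ ^ 3 with hq
  have h₅ : q ≤ 8 := by
    have : q * (T - U) ≤ 8 * (T - U) := by linarith
    exact le_of_mul_le_mul_right this hS
  have hX : A * (1 + P₁ ^ 2) + 2 * b * (-(P₀ * P₁)) + c * (1 + P₀ ^ 2) = q * R ^ 3 := by
    have : q * R ^ 3 =
        (A + c) * R ^ 2 - (A * P₀ ^ 2 + 2 * b * P₀ * P₁ + c * P₁ ^ 2) := by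
      rw [hq]; field_simp
    rw [this, hRsq]; ring
  obtain ⟨hX0, hX2⟩ := four_mul_det_mul_det_le (A' := 1 + P₁ ^ 2) (b' := -(P₀ * P₁))
    (c' := 1 + P₀ ^ 2) hA (by positivity) hD (by nlinarith [sq_nonneg P₀, sq_nonneg P₁])
  rw [hX] at hX0 hX2
  have hdet' : (1 + P₁ ^ 2) * (1 + P₀ ^ 2) - (-(P₀ * P₁)) ^ 2 = R ^ 2 := by rw [hRsq]; ring
  rw [hdet'] at hX2
  have h₆ : (q * R ^ 3) ^ 2 ≤ (8 * R ^ 3) ^ 2 :=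
    pow_le_pow_left₀ hX0.le (mul_le_mul_of_nonneg_right h₅ (by positivity)) 2
  have h₇ : (A * c - b ^ 2) * R ^ 2 ≤ (2 * R) ^ 4 * R ^ 2 := by linarith
  exact le_of_mul_le_mul_right h₇ (by positivity)

namespace Sol

variable (S : Sol) {x₀ : E 2}

/-- The second derivatives of `R`. -/
def HR (x : E 2) (i j : Fin 2) : ℝ :=
  2 * (S.a x 0 i * S.a x 0 j + S.p x 0 * S.c x 0 i j +
    (S.a x 1 i * S.a x 1 j + S.p x 1 * S.c x 1 i j)) / (2 * S.R x) -
  2 * (S.p x 0 * S.a x 0 i + S.p x 1 * S.a x 1 i) *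
    (2 * (S.p x 0 * S.a x 0 j + S.p x 1 * S.a x 1 j)) / (4 * S.R x ^ 3)

theorem jet_R (x : E 2) : Jet S.R x
    (fun i => 2 * (S.p x 0 * S.a x 0 i + S.p x 1 * S.a x 1 i) / (2 * S.R x)) (S.HR x) := by
  have h : Jet (fun y => S.p y 0 * S.p y 0 + S.p y 1 * S.p y 1 + 1) x
      (fun i => 2 * (S.p x 0 * S.a x 0 i + S.p x 1 * S.a x 1 i))
      (fun i j => 2 * (S.a x 0 i * S.a x 0 j + S.p x 0 * S.c x 0 i j +
        (S.a x 1 i * S.a x 1 j + S.p x 1 * S.c x 1 i j))) := by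
    refine Jet.add_const 1 (Jet.of_grad
      (G := fun y i => 2 * (S.p y 0 * S.a y 0 i + S.p y 1 * S.a y 1 i))
      (fun y => ?_) (fun i => ?_))
    · exact (((S.grad_p y 0).mul (S.grad_p y 0)).add
        ((S.grad_p y 1).mul (S.grad_p y 1))).congr (by ring) (by ring)
    · exact ((((S.grad_p x 0).mul (S.grad_a x 0 i)).add
        ((S.grad_p x 1).mul (S.grad_a x 1 i))).const_mul 2).congr (by ring) (by ring)
  exact h.sqrt (by nlinarith [mul_self_nonneg (S.p x 0), mul_self_nonneg (S.p x 1)])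

theorem lam_HR (x : E 2) : lam (S.a x) (S.HR x) =
    (S.a x 0 0 * S.a x 1 1 - S.a x 0 1 ^ 2) *
      ((S.a x 0 0 + S.a x 1 1 - 4 * (S.p x 0 * S.s x 0 + S.p x 1 * S.s x 1)) * (S.R x)⁻¹ -
      (S.a x 0 0 * S.p x 0 ^ 2 + 2 * S.a x 0 1 * S.p x 0 * S.p x 1 +
        S.a x 1 1 * S.p x 1 ^ 2) * (S.R x)⁻¹ ^ 3) := by
  have h0 := S.lam_c x 0
  have h1 := S.lam_c x 1
  have hR : S.R x ≠ 0 := by linarith [S.one_le_R x]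
  simp only [lam, HR, S.c_symm_left, S.c_110, S.c_010, S.a_symm] at h0 h1 ⊢
  linear_combination (S.p x 0 * (S.R x)⁻¹) * h0 + (S.p x 1 * (S.R x)⁻¹) * h1

/-- The auxiliary function of the determinant estimate. -/
def m (x₀ : E 2) (C : ℝ) (x : E 2) : ℝ := S.V x₀ x + -(1 / 2) * S.R x + C

theorem jet_m (x₀ x : E 2) (C : ℝ) : Jet (S.m x₀ C) x
    (fun i => S.N x₀ x i +
      -(1 / 2) * (2 * (S.p x 0 * S.a x 0 i + S.p x 1 * S.a x 1 i) / (2 * S.R x)))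
    (fun i j => S.a x i j + (S.c x i 0 j * (x 0 - x₀ 0) + S.c x i 1 j * (x 1 - x₀ 1)) +
      -(1 / 2) * S.HR x i j) :=
  ((S.jet_V x₀ x).add ((S.jet_R x).const_mul (-(1 / 2)))).add_const C

theorem bil_nonneg (x : E 2) (g : Fin 2 → ℝ) : 0 ≤ bil (S.a x) g g :=
  bil_self_nonneg (S.a_pos x) (S.det_pos x) g

/-- The determinant estimate at a maximum point of the auxiliary function. -/
theorem exp_neg_t_le_of_isLocalMin {C T : ℝ} {x : E 2} (hC : C ≤ T) (hT : S.u x < T)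
    (hm : 0 < S.m x₀ C x)
    (hx : IsLocalMin (fun y => S.t y + (-1) * Real.log (T - S.u y) + Real.log (S.m x₀ C y)) x) :
    Real.exp (-S.t x) ≤ 2 * S.R x := by
  have hS : 0 < T - S.u x := by linarith
  have hR1 := S.one_le_R x
  have hR : 0 < S.R x := by linarith
  have jet := ((S.jet_t x).add ((((S.jet_u x).const_sub T).log hS).const_mul (-1))).add
    ((S.jet_m x₀ x C).log hm)
  have hg₀ := jet.grad.eq_zero hx 0
  have hg₁ := jet.grad.eq_zero hx 1
  have hl := jet.lam_nonneg hx (S.a_pos x) (S.det_pos x)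
  have hV := S.lam_V x₀ x
  have hHR := S.lam_HR x
  have ht := S.pde x
  have hPP := S.bil_nonneg x (S.p x)
  have hD := S.det_pos x
  have hA := S.a_pos x
  have hsymm := S.a_symm x
  have hdet := S.det_eq x
  have hRsq := S.R_sq x
  have hmV : S.m x₀ C x =
    (x 0 - x₀ 0) * S.p x 0 + (x 1 - x₀ 1) * S.p x 1 - S.u x + -(1 / 2) * S.R x + C := rfl
  simp only [bil, lam, hsymm] at hl hV hHR ht hPP
  simp only [N, hsymm] at hg₀ hg₁ hl
  simp only [div_eq_mul_inv, ← inv_pow] at hl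
  have key := bil_comb_expansion (A := S.a x 0 0) (b := S.a x 0 1) (c := S.a x 1 1)
    (P₀ := S.p x 0) (P₁ := S.p x 1) (y₀ := x 0 - x₀ 0) (y₁ := x 1 - x₀ 1) (s₀ := S.s x 0)
    (s₁ := S.s x 1) (σ := (T - S.u x)⁻¹) (μ := (S.m x₀ C x)⁻¹) (ρ := (S.R x)⁻¹) rfl rfl
    (by rw [← sub_eq_zero, ← hg₀]; ring) (by rw [← sub_eq_zero, ← hg₁]; ring)
  have h₈ : Real.exp (-S.t x) ^ 4 ≤ (2 * S.R x) ^ 4 := by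
    rw [← Real.exp_nat_mul]
    refine le_trans (le_of_eq ?_) (det_le_of_comb_nonneg hA hD hS hC hm hR hRsq hmV ?_)
    · rw [hdet]; congr 1; push_cast; ring
    · have hPP' := mul_nonneg hPP (sq_nonneg (T - S.u x)⁻¹)
      linear_combination hl + 2 * hPP' + key + ht + (S.m x₀ C x)⁻¹ * hV -
        (1 / 2) * (S.m x₀ C x)⁻¹ * hHR
  exact (pow_le_pow_iff_left₀ (Real.exp_pos _).le (by positivity) (by norm_num)).1 h₈

end Sol

namespace Sol

open Filter Topology

variable {S : Sol} {x₀ : E 2}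

theorem Normalized.isCompact_sublevel (hS : S.Normalized x₀) (T : ℝ) :
    IsCompact {x | S.u x ≤ T} := by
  obtain ⟨ε, hε, h⟩ := hS.exists_bound
  refine Metric.isCompact_of_isClosed_isBounded (isClosed_le S.continuous_u continuous_const) ?_
  refine (Metric.isBounded_closedBall (x := x₀) (r := max 1 (T / ε))).subset ?_
  intro x hx
  rw [mem_closedBall_iff_norm]
  rcases le_total ‖x - x₀‖ 1 with h1 | h1
  · exact le_max_of_le_left h1
  · refine le_max_of_le_right ?_
    rw [le_div_iff₀ hε, mul_comm]
    exact (h x h1).1.trans hx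

/-- The determinant estimate: a lower bound for the determinant of the Hessian in terms of the
Legendre transform. -/
theorem Normalized.exp_neg_t_le (hS : S.Normalized x₀) :
    ∃ C, 0 < C ∧ ∀ x, Real.exp (-S.t x) ≤ 4 * (S.V x₀ x + C) := by
  obtain ⟨C, hC, hR⟩ := hS.exists_R_le
  have hRm : ∀ x, S.R x ≤ 2 * S.m x₀ C x := fun x => by unfold m; linarith [hR x]
  have hm : ∀ x, 0 < S.m x₀ C x := fun x => by linarith [hRm x, S.one_le_R x]
  have hmV : ∀ x, S.m x₀ C x ≤ S.V x₀ x + C := fun x => by unfold m; linarith [S.one_le_R x]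
  have hmc : Continuous (S.m x₀ C) := by
    have h1 := S.continuous_V x₀
    have h2 := S.continuous_R
    unfold m; fun_prop
  have hT : ∀ T, C ≤ T → ∀ x, S.u x < T →
      Real.exp (-S.t x) * (T - S.u x) ≤ 4 * T * S.m x₀ C x := by
    intro T hCT x hx
    set ζ : E 2 → ℝ := fun y => Real.exp (-S.t y) * (T - S.u y) / S.m x₀ C y with hζ
    have hζc : Continuous ζ := by
      have h1 := S.continuous_t
      have h2 := S.continuous_u
      exact Continuous.div (by fun_prop) hmc fun y => (hm y).ne'
    obtain ⟨z, hz, hzmax⟩ := (hS.isCompact_sublevel T).exists_isMaxOn ⟨x, hx.le⟩ hζc.continuousOn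
    have hζx : 0 < ζ x := div_pos (mul_pos (Real.exp_pos _) (by linarith)) (hm x)
    have hζz : 0 < ζ z := hζx.trans_le (hzmax hx.le)
    have hzT : S.u z < T := by
      refine lt_of_le_of_ne hz fun h => ?_
      simp [hζ, h] at hζz
    have hlog : ∀ y, S.u y < T →
        S.t y + (-1) * Real.log (T - S.u y) + Real.log (S.m x₀ C y) = -Real.log (ζ y) := by
      intro y hy
      have hy' : 0 < T - S.u y := by linarith
      rw [hζ, Real.log_div (by positivity) (hm y).ne', Real.log_mul (Real.exp_pos _).ne' hy'.ne',
        Real.log_exp]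
      ring
    have hmin : IsLocalMin
        (fun y => S.t y + (-1) * Real.log (T - S.u y) + Real.log (S.m x₀ C y)) z := by
      filter_upwards [(isOpen_lt S.continuous_u continuous_const).mem_nhds hzT] with y hy
      rw [hlog y hy, hlog z hzT]
      have hζy : 0 < ζ y := div_pos (mul_pos (Real.exp_pos _) (sub_pos.2 hy)) (hm y)
      exact neg_le_neg (Real.log_le_log hζy (hzmax (le_of_lt hy)))
    have h1 := S.exp_neg_t_le_of_isLocalMin hCT hzT (hm z) hmin
    have h2 : ζ z ≤ 4 * T := by
      rw [hζ]
      simp only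
      rw [div_le_iff₀ (hm z)]
      have h3 : Real.exp (-S.t z) ≤ 4 * S.m x₀ C z := by linarith [hRm z]
      have h4 : T - S.u z ≤ T := by linarith [hS.u_nonneg z]
      have := mul_le_mul h3 h4 (sub_pos.2 hzT).le (by linarith [hm z])
      linarith
    have h3 : ζ x ≤ 4 * T := (hzmax hx.le).trans h2
    rwa [hζ, div_le_iff₀ (hm x)] at h3
  refine ⟨C, hC, fun x => ?_⟩
  refine le_trans ?_ (mul_le_mul_of_nonneg_left (hmV x) (by norm_num))
  by_contra! hlt
  set δ := Real.exp (-S.t x) - 4 * S.m x₀ C x with hδ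
  have hδ0 : 0 < δ := by linarith
  have hu := hS.u_nonneg x
  set T := C + S.u x + Real.exp (-S.t x) * S.u x / δ with hTdef
  have hq : 0 ≤ Real.exp (-S.t x) * S.u x / δ := by positivity
  have h1 := hT T (by linarith) x (by linarith)
  have h2 : T * δ = (C + S.u x) * δ + Real.exp (-S.t x) * S.u x := by
    rw [hTdef]; field_simp
  have h3 : 0 < (C + S.u x) * δ := by positivity
  have h4 : T * δ = T * Real.exp (-S.t x) - 4 * T * S.m x₀ C x := by rw [hδ]; ring
  linarith

/-- The sum of `t` with the logarithms of `u` and of its Legendre transform. -/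
def W (S : Sol) (x₀ x : E 2) : ℝ := Real.log (S.u x) + Real.log (S.V x₀ x) + S.t x

theorem Normalized.tendsto_W (hS : S.Normalized x₀) (K : ℝ) :
    ∃ r, ∀ x, r ≤ ‖x - x₀‖ → K ≤ S.W x₀ x := by
  obtain ⟨ε, hε, h⟩ := hS.exists_bound
  obtain ⟨C, hC, hV⟩ := hS.exp_neg_t_le
  set β := ε / (4 * (ε + C)) with hβ
  have hβ0 : 0 < β := by positivity
  refine ⟨max 1 (Real.exp K / (ε * β)), fun x hx => ?_⟩
  obtain ⟨h1, h2⟩ := h x ((le_max_left _ _).trans hx)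
  have h3 : Real.exp K / (ε * β) ≤ ‖x - x₀‖ := (le_max_right _ _).trans hx
  have hn : 0 < ‖x - x₀‖ := zero_lt_one.trans_le ((le_max_left _ _).trans hx)
  have hu : 0 < S.u x := (by positivity : 0 < ε * ‖x - x₀‖).trans_le h1
  have hVx : 0 < S.V x₀ x := hε.trans_le h2
  have h4 : Real.exp K ≤ S.u x * S.V x₀ x * Real.exp (S.t x) := by
    have e1 : β ≤ S.V x₀ x * Real.exp (S.t x) := by
      have e2 : 1 ≤ 4 * (S.V x₀ x + C) * Real.exp (S.t x) := by
        have := mul_le_mul_of_nonneg_right (hV x) (Real.exp_pos (S.t x)).le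
        rwa [← Real.exp_add, neg_add_cancel, Real.exp_zero] at this
      have e3 : β * (4 * (S.V x₀ x + C)) ≤ S.V x₀ x := by
        rw [hβ, div_mul_eq_mul_div, div_le_iff₀ (by positivity)]
        nlinarith
      have e4 := mul_le_mul_of_nonneg_left e2 hβ0.le
      have e5 := mul_le_mul_of_nonneg_right e3 (Real.exp_pos (S.t x)).le
      linarith
    rw [div_le_iff₀ (by positivity)] at h3
    calc Real.exp K ≤ (ε * ‖x - x₀‖) * β := by linarith
      _ ≤ S.u x * (S.V x₀ x * Real.exp (S.t x)) := by gcongr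
      _ = _ := by ring
  rw [W, ← Real.exp_le_exp, Real.exp_add, Real.exp_add, Real.exp_log hu, Real.exp_log hVx]
  exact h4

/-- No interior minimum for a perturbation of a subsolution by `W`. -/
theorem Normalized.not_isLocalMin (hS : S.Normalized x₀) {r : E 2 → ℝ} {x : E 2}
    {g : Fin 2 → ℝ} {H : Fin 2 → Fin 2 → ℝ} (hr : Jet r x g H) (hpos : 0 < r x)
    (hsuper : r x * (lam (S.a x) H + 2 * bil (S.a x) (S.s x) g) + bil (S.a x) g g ≤ 0)
    {ε : ℝ} (hε : 0 < ε) (hx : x ≠ x₀) :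
    ¬ IsLocalMin (fun y => r y + ε * S.W x₀ y) x := by
  intro hmin
  have hu := hS.u_pos hx
  have hV := hS.V_pos hx
  have jW := (((S.jet_u x).log hu).add ((S.jet_V x₀ x).log hV)).add (S.jet_t x)
  have jet := hr.add (jW.const_mul ε)
  have hg := fun i => jet.grad.eq_zero hmin i
  have hl := jet.lam_nonneg hmin (S.a_pos x) (S.det_pos x)
  set η : Fin 2 → ℝ := fun i => S.p x i / S.u x - S.N x₀ x i / S.V x₀ x - S.s x i with hη
  have key : ε * bil (S.a x) η η ≤ lam (S.a x) H + 2 * bil (S.a x) (S.s x) g := by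
    have hlV := S.lam_V x₀ x
    have hla := S.lam_a x
    have hpde := S.pde x
    have hg₀ := hg 0
    have hg₁ := hg 1
    have hσ : S.u x * (S.u x)⁻¹ = 1 := mul_inv_cancel₀ hu.ne'
    have hμ : S.V x₀ x * (S.V x₀ x)⁻¹ = 1 := mul_inv_cancel₀ hV.ne'
    have hVdef : S.V x₀ x =
      (x 0 - x₀ 0) * S.p x 0 + (x 1 - x₀ 1) * S.p x 1 - S.u x := rfl
    simp only [lam, bil, N, hη, S.a_symm, div_eq_mul_inv, ← inv_pow] at hl hlV hla hpde hg₀ hg₁ ⊢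
    generalize (S.u x)⁻¹ = σ at *
    generalize (S.V x₀ x)⁻¹ = μ at *
    generalize S.V x₀ x = v at *
    linear_combination hl + ε * σ * hla + ε * μ * hlV + ε * hpde -
      2 * (S.a x 1 1 * S.s x 0 - S.a x 0 1 * S.s x 1) * hg₀ -
      2 * (S.a x 0 0 * S.s x 1 - S.a x 0 1 * S.s x 0) * hg₁ +
      2 * ε * (S.a x 0 0 * S.a x 1 1 - S.a x 0 1 ^ 2) * (σ * μ * hVdef - μ * hσ - σ * hμ)
  have hgg := S.bil_nonneg x g
  have hηη := S.bil_nonneg x η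
  have hsum : r x * ε * bil (S.a x) η η + bil (S.a x) g g ≤ 0 := by
    have := mul_le_mul_of_nonneg_left key hpos.le
    linarith
  have hrε : 0 < r x * ε := mul_pos hpos hε
  have h1 : bil (S.a x) g g ≤ 0 := by
    have := mul_nonneg hrε.le hηη
    linarith
  have h2 : bil (S.a x) η η ≤ 0 := by
    have : r x * ε * bil (S.a x) η η ≤ r x * ε * 0 := by linarith
    exact le_of_mul_le_mul_left this hrε
  have hg0 := bil_self_eq_zero (S.a_pos x) (S.det_pos x) h1
  have hη0 := bil_self_eq_zero (S.a_pos x) (S.det_pos x) h2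
  have hp : ∀ i, S.p x i = 0 := by
    intro i
    have e1 := hg i
    have e2 := hη0 i
    simp only [hg0, hη] at e1 e2
    have e3 : S.p x i / S.u x + S.N x₀ x i / S.V x₀ x + S.s x i = 0 := by
      simpa [hε.ne'] using e1
    have e4 : S.p x i / S.u x = 0 := by linarith
    exact (div_eq_zero_iff.1 e4).resolve_right hu.ne'
  have : S.V x₀ x + S.u x = 0 := by simp [V, hp]
  linarith

end Sol

namespace Sol

open Filter Topology

variable {S : Sol} {x₀ : E 2}

theorem Normalized.continuousAt_W (hS : S.Normalized x₀) {x : E 2} (hx : x ≠ x₀) :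
    ContinuousAt (S.W x₀) x :=
  ((S.continuous_u.continuousAt.log (hS.u_pos hx).ne').add
    ((S.continuous_V x₀).continuousAt.log (hS.V_pos hx).ne')).add S.continuous_t.continuousAt

theorem Normalized.exists_sphere_le (hS : S.Normalized x₀) {r : E 2 → ℝ} {g : E 2 → Fin 2 → ℝ}
    {H : E 2 → Fin 2 → Fin 2 → ℝ} (jet : ∀ x, Jet r x (g x) (H x)) (hpos : ∀ x, 0 < r x)
    (hsuper : ∀ x, r x * (lam (S.a x) (H x) + 2 * bil (S.a x) (S.s x) (g x)) +
      bil (S.a x) (g x) (g x) ≤ 0) {x : E 2} {ρ : ℝ} (hρ : 0 < ρ) (hρx : ρ ≤ ‖x - x₀‖) :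
    ∃ z ∈ Metric.sphere x₀ ρ, r z ≤ r x := by
  have hrc : Continuous r := continuous_iff_continuousAt.2 fun y => (jet y).grad.continuousAt
  have hne : ∀ {z : E 2}, ρ ≤ ‖z - x₀‖ → z ≠ x₀ := by
    rintro z hz rfl
    simp at hz; linarith
  by_contra! hlt
  have hsne : (Metric.sphere x₀ ρ).Nonempty := NormedSpace.sphere_nonempty.2 hρ.le
  have hWs : ContinuousOn (S.W x₀) (Metric.sphere x₀ ρ) := fun z hz =>
    (hS.continuousAt_W (hne (mem_sphere_iff_norm.1 hz).ge)).continuousWithinAt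
  obtain ⟨z₀, hz₀, hmin₀⟩ := (isCompact_sphere x₀ ρ).exists_isMinOn hsne hrc.continuousOn
  obtain ⟨z₁, hz₁, hmin₁⟩ := (isCompact_sphere x₀ ρ).exists_isMinOn hsne hWs
  have hδ : 0 < r z₀ - r x := sub_pos.2 (hlt z₀ hz₀)
  set M := |S.W x₀ x - S.W x₀ z₁| + 1 with hM
  have hM0 : 0 < M := by positivity
  set ε := (r z₀ - r x) / M with hεdef
  have hε : 0 < ε := div_pos hδ hM0
  have hεM : ε * M = r z₀ - r x := div_mul_cancel₀ _ hM0.ne'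
  have hεW : ε * (S.W x₀ x - S.W x₀ z₁) < r z₀ - r x := by
    rw [← hεM]
    exact mul_lt_mul_of_pos_left ((le_abs_self _).trans_lt (lt_add_one _)) hε
  obtain ⟨r₁, hr₁⟩ := hS.tendsto_W (r x / ε + S.W x₀ x)
  set K : Set (E 2) := {z | ρ ≤ ‖z - x₀‖ ∧ ‖z - x₀‖ ≤ max r₁ ‖x - x₀‖} with hK
  have hcn : Continuous fun y : E 2 => ‖y - x₀‖ := by fun_prop
  have hKc : IsCompact K := by
    refine Metric.isCompact_of_isClosed_isBounded ?_ ?_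
    · exact (isClosed_le continuous_const hcn).inter
        (isClosed_le hcn continuous_const)
    · exact (Metric.isBounded_closedBall (x := x₀) (r := max r₁ ‖x - x₀‖)).subset fun z hz =>
        mem_closedBall_iff_norm.2 hz.2
  have hxK : x ∈ K := ⟨hρx, le_max_right _ _⟩
  have hΦ : ContinuousOn (fun y => r y + ε * S.W x₀ y) K := fun z hz =>
    (hrc.continuousAt.add
      ((hS.continuousAt_W (hne hz.1)).const_mul ε)).continuousWithinAt
  obtain ⟨z, hz, hzmin⟩ := hKc.exists_isMinOn ⟨x, hxK⟩ hΦ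
  have hzx : r z + ε * S.W x₀ z ≤ r x + ε * S.W x₀ x := hzmin hxK
  have hz1 : ρ < ‖z - x₀‖ := by
    refine lt_of_le_of_ne hz.1 fun h => ?_
    have hs : z ∈ Metric.sphere x₀ ρ := mem_sphere_iff_norm.2 h.symm
    have h1 : r z₀ ≤ r z := hmin₀ hs
    have h2 : ε * S.W x₀ z₁ ≤ ε * S.W x₀ z := mul_le_mul_of_nonneg_left (hmin₁ hs) hε.le
    linarith
  have hz2 : ‖z - x₀‖ < r₁ := by
    by_contra! h
    have h1 := mul_le_mul_of_nonneg_left (hr₁ z h) hε.le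
    rw [mul_add, mul_div_cancel₀ _ hε.ne'] at h1
    linarith [hpos z]
  refine hS.not_isLocalMin (jet z) (hpos z) (hsuper z) hε (hne hz.1) ?_
  refine hzmin.isLocalMin ?_
  filter_upwards [(isOpen_lt continuous_const hcn).mem_nhds hz1,
    (isOpen_lt hcn continuous_const).mem_nhds hz2] with y hy1 hy2
  exact ⟨le_of_lt hy1, (le_of_lt hy2).trans (le_max_left _ _)⟩

variable (S)

theorem le_of_super {r : E 2 → ℝ} {g : E 2 → Fin 2 → ℝ}
    {H : E 2 → Fin 2 → Fin 2 → ℝ} (jet : ∀ x, Jet r x (g x) (H x)) (hpos : ∀ x, 0 < r x)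
    (hsuper : ∀ x, r x * (lam (S.a x) (H x) + 2 * bil (S.a x) (S.s x) (g x)) +
      bil (S.a x) (g x) (g x) ≤ 0) (x₀ x : E 2) : r x₀ ≤ r x := by
  by_contra! hlt
  have hne : x ≠ x₀ := by rintro rfl; exact lt_irrefl _ hlt
  obtain ⟨δ, hδ, hball⟩ :=
    Metric.eventually_nhds_iff.1 ((jet x₀).grad.continuousAt.eventually (lt_mem_nhds hlt))
  have hn : 0 < ‖x - x₀‖ := norm_pos_iff.2 (sub_ne_zero.2 hne)
  obtain ⟨z, hz, hle⟩ := (S.tilt_normalized x₀).exists_sphere_le jet hpos hsuper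
    (ρ := min (δ / 2) ‖x - x₀‖) (lt_min (half_pos hδ) hn) (min_le_right _ _)
  have hd : dist z x₀ < δ := by
    rw [Metric.mem_sphere.1 hz]
    exact (min_le_left _ _).trans_lt (half_lt_self hδ)
  exact absurd hle (not_le.2 (hball hd))

/-- A Liouville theorem. -/
theorem grad_eq_zero_of_super {r : E 2 → ℝ} {g : E 2 → Fin 2 → ℝ}
    {H : E 2 → Fin 2 → Fin 2 → ℝ} (jet : ∀ x, Jet r x (g x) (H x)) (hpos : ∀ x, 0 < r x)
    (hsuper : ∀ x, r x * (lam (S.a x) (H x) + 2 * bil (S.a x) (S.s x) (g x)) +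
      bil (S.a x) (g x) (g x) ≤ 0) (x : E 2) (i : Fin 2) : g x i = 0 :=
  (jet x).grad.eq_zero (Eventually.of_forall fun y => S.le_of_super jet hpos hsuper x y) i

/-- The determinant of the Hessian of an entire solution is constant. -/
theorem s_eq_zero (x : E 2) (i : Fin 2) : S.s x i = 0 := by
  have h := S.grad_eq_zero_of_super (fun y => ((S.jet_t y).const_mul (1 / 2)).exp)
    (fun y => Real.exp_pos _) (fun y => le_of_eq ?_) x i
  · simpa using h
  · have hp := S.pde y
    simp only [lam, bil] at hp ⊢
    linear_combination (1 / 2) * Real.exp (1 / 2 * S.t y) ^ 2 * hp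

end Sol

namespace Sol

variable (S : Sol)

theorem a11_pos (x : E 2) : 0 < S.a x 1 1 := by
  have h : 0 < S.a x 0 0 * S.a x 1 1 := by linarith [S.det_pos x, sq_nonneg (S.a x 0 1)]
  exact (mul_pos_iff_of_pos_left (S.a_pos x)).1 h

theorem d_010 (x : E 2) (l : Fin 2) : S.d x 0 1 0 l = S.d x 0 0 1 l := by
  have h : (fun y => S.c y 0 1 0) = fun y => S.c y 0 0 1 := funext S.c_010
  have h1 := S.grad_c x 0 1 0
  rw [h] at h1
  exact h1.unique (S.grad_c x 0 0 1) l

theorem d_110 (x : E 2) (l : Fin 2) : S.d x 1 1 0 l = S.d x 0 1 1 l := by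
  have h : (fun y => S.c y 1 1 0) = fun y => S.c y 0 1 1 := funext S.c_110
  have h1 := S.grad_c x 1 1 0
  rw [h] at h1
  exact h1.unique (S.grad_c x 0 1 1) l

theorem d_1100 (x : E 2) : S.d x 1 1 0 0 = S.d x 0 0 1 1 := by
  rw [d_110, d_symm, d_010]

theorem c_linear (x : E 2) (k : Fin 2) :
    S.a x 1 1 * S.c x 0 0 k + S.a x 0 0 * S.c x 1 1 k - 2 * S.a x 0 1 * S.c x 0 1 k = 0 := by
  rw [S.det_deriv, S.s_eq_zero]; ring

theorem d_linear (x : E 2) (k l : Fin 2) :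
    S.a x 1 1 * S.d x 0 0 k l + S.a x 0 0 * S.d x 1 1 k l - 2 * S.a x 0 1 * S.d x 0 1 k l =
      2 * S.c x 0 1 k * S.c x 0 1 l - S.c x 0 0 k * S.c x 1 1 l - S.c x 1 1 k * S.c x 0 0 l := by
  have h := (((S.grad_a x 1 1).mul (S.grad_c x 0 0 k)).add
    ((S.grad_a x 0 0).mul (S.grad_c x 1 1 k))).sub
    (((S.grad_a x 0 1).const_mul 2).mul (S.grad_c x 0 1 k))
  rw [show (fun y => S.a y 1 1 * S.c y 0 0 k + S.a y 0 0 * S.c y 1 1 k -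
    2 * S.a y 0 1 * S.c y 0 1 k) = fun _ => (0 : ℝ) from funext fun y => S.c_linear y k] at h
  have := h.unique (Grad.const 0 x) l
  linear_combination this

theorem lam_d_mul (x : E 2) (i : Fin 2) :
    lam (S.a x) (S.d x i i) * S.a x i i = 2 * bil (S.a x) (S.c x i i) (S.c x i i) := by
  have h1 := S.c_linear x i
  have h2 := S.d_linear x i i
  fin_cases i
  · simp only [Fin.zero_eta, lam, bil, c_010, c_110, d_010, d_110, d_symm S x 0 0 1 0] at *
    rw [S.d_symm x 0 1 1 0, S.d_010] at h2
    linear_combination S.a x 0 0 * h2 - 2 * S.c x 0 0 0 * h1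
  · simp only [Fin.mk_one, lam, bil, S.c_110, S.d_1100, S.d_110, S.d_symm x 1 1 1 0] at *
    linear_combination S.a x 1 1 * h2 - 2 * S.c x 1 1 1 * h1

theorem c_diag_eq_zero (x : E 2) (i k : Fin 2) : S.c x i i k = 0 := by
  have hpos : ∀ y, 0 < S.a y i i := fun y => by
    fin_cases i
    · exact S.a_pos y
    · exact S.a11_pos y
  have h := S.grad_eq_zero_of_super (fun y => (((Jet.of_grad (fun z => S.grad_a z i i)
    (S.grad_c y i i)).log (hpos y)).const_mul (-(1 / 2))).exp) (fun y => Real.exp_pos _)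
    (fun y => le_of_eq ?_) x k
  · have := (hpos x).ne'
    simpa [this] using h
  · have hd := S.lam_d_mul y i
    have hs := S.s_eq_zero y
    have hσ : S.a y i i * (S.a y i i)⁻¹ = 1 := mul_inv_cancel₀ (hpos y).ne'
    simp only [lam, bil, hs, div_eq_mul_inv, ← inv_pow] at hd ⊢
    generalize (S.a y i i)⁻¹ = σ at *
    generalize Real.exp _ = R
    linear_combination (-(1 / 2)) * R ^ 2 * σ ^ 2 * hd + (1 / 2) * R ^ 2 * σ *
      (S.a y 1 1 * S.d y i i 0 0 - S.a y 0 1 * (S.d y i i 0 1 + S.d y i i 1 0) +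
        S.a y 0 0 * S.d y i i 1 1) * hσ

theorem c_eq_zero (x : E 2) (i j k : Fin 2) : S.c x i j k = 0 := by
  have h0 := S.c_diag_eq_zero x 0
  have h1 := S.c_diag_eq_zero x 1
  have h010 := S.c_010 x
  have h110 := S.c_110 x
  have hl := S.c_symm_left x
  fin_cases i <;> fin_cases j <;> fin_cases k <;> simp_all

/-- An entire solution is a quadratic polynomial. -/
theorem eq_quadratic (x : E 2) : S.u x = 1 / 2 * (∑ i, ∑ j, S.a 0 i j * x i * x j) +
    (∑ i, S.p 0 i * x i) + S.u 0 := by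
  have ha : ∀ y i j, S.a y i j = S.a 0 i j := fun y i j =>
    Grad.is_const (fun z => (S.grad_a z i j).congr (S.c_eq_zero z i j 0) (S.c_eq_zero z i j 1)) y 0
  have hp : ∀ y i, S.p y i = S.a 0 i 0 * y 0 + S.a 0 i 1 * y 1 + S.p 0 i := by
    intro y i
    have h := Grad.is_const (f := fun z => S.p z i - (S.a 0 i 0 * z 0 + S.a 0 i 1 * z 1))
      (fun z => ((S.grad_p z i).sub (((Grad.coord z 0).const_mul _).add
        ((Grad.coord z 1).const_mul _))).congr (by simp [ha]) (by simp [ha])) y 0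
    simp at h
    linarith
  have h := Grad.is_const (f := fun z => S.u z - (1 / 2 * (S.a 0 0 0 * (z 0 * z 0) +
    2 * S.a 0 0 1 * (z 0 * z 1) + S.a 0 1 1 * (z 1 * z 1)) + (S.p 0 0 * z 0 + S.p 0 1 * z 1)))
    (fun z => ((S.grad_u z).sub (((((((Grad.coord z 0).mul (Grad.coord z 0)).const_mul _).add
      (((Grad.coord z 0).mul (Grad.coord z 1)).const_mul _)).add
      (((Grad.coord z 1).mul (Grad.coord z 1)).const_mul _)).const_mul _).add
      (((Grad.coord z 0).const_mul _).add ((Grad.coord z 1).const_mul _)))).congr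
      (by simp [hp z]; ring) (by simp [hp z, S.a_symm]; ring)) x 0
  simp [Fin.sum_univ_two, S.a_symm] at h ⊢
  linarith

end Sol

/-- The `i`-th partial derivative. -/
def pd (i : Fin 2) (f : E 2 → ℝ) (x : E 2) : ℝ := fderiv ℝ f x (EuclideanSpace.single i 1)

theorem grad_pd {f : E 2 → ℝ} (hf : Differentiable ℝ f) (x : E 2) :
    Grad f x fun i => pd i f x := by
  have h := (hf x).hasFDerivAt
  rwa [lin_eq (g := fun i => pd i f x) rfl rfl] at h

theorem contDiff_pd {f : E 2 → ℝ} {m n : WithTop ℕ∞} (hf : ContDiff ℝ n f) (hmn : m + 1 ≤ n)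
    (i : Fin 2) : ContDiff ℝ m (pd i f) :=
  (hf.fderiv_right hmn).clm_apply contDiff_const

theorem iteratedFDeriv_two_eq_pd {f : E 2 → ℝ} (hf : ContDiff ℝ 2 f) (x : E 2) (i j : Fin 2) :
    iteratedFDeriv ℝ 2 f x ![EuclideanSpace.single i 1, EuclideanSpace.single j 1] =
      pd i (pd j f) x := by
  rw [iteratedFDeriv_two_apply]
  have h : DifferentiableAt ℝ (fderiv ℝ f) x :=
    (hf.fderiv_right (m := 1) (by norm_num)).differentiable (by norm_num) x
  change _ = fderiv ℝ (fun y => fderiv ℝ f y (EuclideanSpace.single j 1)) x _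
  rw [fderiv_clm_apply h (by fun_prop)]
  simp

theorem pd_comm {f : E 2 → ℝ} (hf : ContDiff ℝ 2 f) (x : E 2) (i j : Fin 2) :
    pd i (pd j f) x = pd j (pd i f) x := by
  rw [← iteratedFDeriv_two_eq_pd hf, ← iteratedFDeriv_two_eq_pd hf, iteratedFDeriv_two_apply,
    iteratedFDeriv_two_apply]
  exact (hf.contDiffAt.isSymmSndFDerivAt (by simp)).eq _ _

theorem Grad.pd_eq {f : E 2 → ℝ} {x : E 2} {g : Fin 2 → ℝ} (h : Grad f x g) (i : Fin 2) :
    pd i f x = g i := by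
  rw [pd, HasFDerivAt.fderiv h, lin_apply]
  fin_cases i <;> simp

/-- The affine maximal surface equation in terms of the logarithm of the determinant. -/
theorem lam_of_Lop_eq_zero {u t : E 2 → ℝ} (ht : ContDiff ℝ 2 t)
    (hdet : ∀ x, (Hess u x).det = Real.exp (-4 * t x)) {x : E 2}
    (hsymm : Hess u x 1 0 = Hess u x 0 1) (h : Lop 2 u x = 0) :
    lam (Hess u x) (fun i j => pd j (pd i t) x) =
      -3 * bil (Hess u x) (fun i => pd i t x) (fun i => pd i t x) := by
  have hw : wFn 2 u = fun y => Real.exp (3 * t y) := by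
    funext y
    rw [wFn, hdet, ← Real.exp_mul]
    congr 1
    push_cast
    ring
  have ht1 : ∀ i, ContDiff ℝ 1 (pd i t) := contDiff_pd ht (by norm_num)
  have hgrad : ∀ y, Grad (fun y => Real.exp (3 * t y)) y
      fun i => Real.exp (3 * t y) * (3 * pd i t y) := fun y =>
    ((grad_pd (ht.differentiable (by norm_num)) y).const_mul 3).comp (Real.hasDerivAt_exp _)
  have hpd : ∀ j, pd j (fun y => Real.exp (3 * t y)) =
      fun y => Real.exp (3 * t y) * (3 * pd j t y) := fun j => funext fun y => (hgrad y).pd_eq j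
  have hpd2 : ∀ i j, pd i (pd j fun y => Real.exp (3 * t y)) x =
      Real.exp (3 * t x) * (3 * pd i (pd j t) x + 9 * pd i t x * pd j t x) := by
    intro i j
    rw [hpd, ((hgrad x).mul
      ((grad_pd ((ht1 j).differentiable (by norm_num)) x).const_mul 3)).pd_eq i]
    ring
  have hexp : ContDiff ℝ 2 fun y => Real.exp (3 * t y) := (contDiff_const.mul ht).exp
  simp only [Lop, hw, iteratedFDeriv_two_eq_pd hexp, hpd2, Fin.sum_univ_two,
    Matrix.adjugate_fin_two, Matrix.of_apply, Matrix.cons_val_zero, Matrix.cons_val_one,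
    Matrix.cons_val', Matrix.cons_val_fin_one, hsymm] at h
  have h0 : 3 * Real.exp (3 * t x) ≠ 0 := by positivity
  refine mul_left_cancel₀ h0 ?_
  simp only [lam, bil]
  linear_combination h

/-- The solution of the affine maximal surface equation given by `u`. -/
def Sol.of (u : E 2 → ℝ) (hu : ContDiff ℝ 4 u) (hconv : ∀ x : E 2, (Hess u x).PosDef)
    (hmax : ∀ x : E 2, Lop 2 u x = 0) : Sol :=
  have h3 : ∀ i, ContDiff ℝ 3 (pd i u) := contDiff_pd hu (by norm_num)
  have h2 : ∀ i j, ContDiff ℝ 2 (pd j (pd i u)) := fun i => contDiff_pd (h3 i) (by norm_num)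
  have h1 : ∀ i j k, ContDiff ℝ 1 (pd k (pd j (pd i u))) := fun i j =>
    contDiff_pd (h2 i j) (by norm_num)
  have hu2 : ContDiff ℝ 2 u := hu.of_le (by norm_num)
  have hH : ∀ x i j, Hess u x i j = pd i (pd j u) x := iteratedFDeriv_two_eq_pd hu2
  have hdet : ∀ x, (Hess u x).det =
      pd 0 (pd 0 u) x * pd 1 (pd 1 u) x - pd 1 (pd 0 u) x ^ 2 := fun x => by
    rw [Matrix.det_fin_two, hH, hH, hH, hH, pd_comm hu2 x 0 1]; ring
  have hpos : ∀ x, 0 < (Hess u x).det := fun x => (hconv x).det_pos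
  have hdet2 : ContDiff ℝ 2 fun x => (Hess u x).det := by
    rw [funext hdet]
    exact ((h2 0 0).mul (h2 1 1)).sub ((h2 0 1).pow 2)
  have ht : ContDiff ℝ 2 fun x => -(1 / 4) * Real.log (Hess u x).det :=
    contDiff_const.mul (hdet2.log fun x => (hpos x).ne')
  have ht1 : ∀ i, ContDiff ℝ 1 (pd i fun x => -(1 / 4) * Real.log (Hess u x).det) :=
    contDiff_pd ht (by norm_num)
  { u := u
    p := fun x i => pd i u x
    a := fun x i j => pd j (pd i u) x
    c := fun x i j k => pd k (pd j (pd i u)) x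
    d := fun x i j k l => pd l (pd k (pd j (pd i u))) x
    t := fun x => -(1 / 4) * Real.log (Hess u x).det
    s := fun x i => pd i (fun x => -(1 / 4) * Real.log (Hess u x).det) x
    h := fun x i j => pd j (pd i fun x => -(1 / 4) * Real.log (Hess u x).det) x
    grad_u := grad_pd (hu.differentiable (by norm_num))
    grad_p := fun x i => grad_pd ((h3 i).differentiable (by norm_num)) x
    grad_a := fun x i j => grad_pd ((h2 i j).differentiable (by norm_num)) x
    grad_c := fun x i j k => grad_pd ((h1 i j k).differentiable (by norm_num)) x
    grad_t := grad_pd (ht.differentiable (by norm_num))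
    grad_s := fun x i => grad_pd ((ht1 i).differentiable (by norm_num)) x
    a_symm := fun x => pd_comm hu2 x 0 1
    c_symm := fun x i j k => pd_comm ((h3 i).of_le (by norm_num)) x k j
    d_symm := fun x i j k l => pd_comm (h2 i j) x l k
    a_pos := fun x => by
      rw [← hH]
      exact (hconv x).diag_pos
    det_eq := fun x => by
      rw [← hdet, ← mul_assoc]
      norm_num
      rw [Real.exp_log (hpos x)]
    pde := fun x => by
      have h := lam_of_Lop_eq_zero ht (fun y => ?_) (by rw [hH, hH, pd_comm hu2]) (hmax x)
      · simp only [lam, bil, hH, pd_comm hu2 x 0 1] at h ⊢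
        exact h
      · rw [← mul_assoc]
        norm_num
        rw [Real.exp_log (hpos y)] }

/-- **Theorem 3.1 (Chern conjecture, analytic form).** An entire `C⁴` locally uniformly convex
solution of the affine maximal surface equation `L[u] = 0` in `ℝ²` is a quadratic polynomial. -/
theorem affine_bernstein_dim_two
    (u : E 2 → ℝ) (hu : ContDiff ℝ 4 u)
    (hconv : ∀ x : E 2, (Hess u x).PosDef)
    (hmax : ∀ x : E 2, Lop 2 u x = 0) :
    ∃ (A : Matrix (Fin 2) (Fin 2) ℝ) (b : E 2) (c : ℝ), A.PosDef ∧
      ∀ x : E 2, u x = (1 / 2) * (∑ i, ∑ j, A i j * x i * x j) + (∑ i, b i * x i) + c := by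
  have hu2 : ContDiff ℝ 2 u := hu.of_le (by norm_num)
  refine ⟨Hess u 0, WithLp.toLp 2 fun i => pd i u 0, u 0, hconv 0, fun x => ?_⟩
  have h := (Sol.of u hu hconv hmax).eq_quadratic x
  have hH : ∀ i j, Hess u 0 i j = pd j (pd i u) 0 := fun i j => by
    rw [pd_comm hu2]; exact iteratedFDeriv_two_eq_pd hu2 0 i j
  simp only [hH]
  exact h

end
end

section
/- Let n ≥ 2, let Ω ⊆ ℝⁿ be an open convex set, and let u : Ω → ℝ be a smooth locally uniformly convex function. Suppose the graph of u is affine complete, i.e. every C¹ curve γ : [0,1) → Ω that eventually leaves every compact subset of Ω has infinite affine length ∫₀¹ (det D²u(γ(t)))^{-1/(2(n+2))} √(⟨D²u(γ(t)) γ'(t), γ'(t)⟩) dt = ∞. Then the graph of u is Euclidean complete: every C¹ curve γ : [0,1) → Ω that eventually leaves every compact subset of Ω satisfies ∫₀¹ √(|γ'(t)|² + ⟨Du(γ(t)), γ'(t)⟩²) dt = ∞. -/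
open MeasureTheory

noncomputable section

/-- A `C¹` curve `γ : [0,1) → Ω` that eventually leaves every compact subset of `Ω`. -/
def IsDivergentCurve {n : ℕ} (Ω : Set (E n)) (γ : ℝ → E n) : Prop :=
  ContDiffOn ℝ 1 γ (Set.Ico 0 1) ∧ (∀ t ∈ Set.Ico (0 : ℝ) 1, γ t ∈ Ω) ∧
  ∀ K ⊆ Ω, IsCompact K → ∃ t₀ ∈ Set.Ico (0 : ℝ) 1, ∀ t, t₀ < t → t < 1 → γ t ∉ K

/-- The velocity `γ'(t)` of a curve `γ : [0,1) → ℝⁿ`. -/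
noncomputable def curveDeriv {n : ℕ} (γ : ℝ → E n) (t : ℝ) : E n :=
  derivWithin γ (Set.Ico 0 1) t

/-- The graph of `u` is affine complete: every divergent `C¹` curve in `Ω` has infinite length
in the affine (Berwald–Blaschke) metric `g = (det D²u)^{-1/(n+2)} D²u`. -/
def AffineComplete {n : ℕ} (Ω : Set (E n)) (u : E n → ℝ) : Prop :=
  ∀ γ : ℝ → E n, IsDivergentCurve Ω γ →
    ∫⁻ t in Set.Ico (0 : ℝ) 1, ENNReal.ofReal
      ((Hess u (γ t)).det ^ (-(1 : ℝ) / (2 * (n + 2))) *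
        Real.sqrt (∑ i, ∑ j, Hess u (γ t) i j * curveDeriv γ t i * curveDeriv γ t j)) = ⊤

/-- The graph of `u` is Euclidean complete: every divergent `C¹` curve in `Ω` has infinite
length in the metric induced from the Euclidean metric on the graph. -/
def EuclideanComplete {n : ℕ} (Ω : Set (E n)) (u : E n → ℝ) : Prop :=
  ∀ γ : ℝ → E n, IsDivergentCurve Ω γ →
    ∫⁻ t in Set.Ico (0 : ℝ) 1, ENNReal.ofReal
      (Real.sqrt (‖curveDeriv γ t‖ ^ 2 + (fderiv ℝ u (γ t) (curveDeriv γ t)) ^ 2)) = ⊤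

section AuxiliaryLemmas

open Set Filter Topology

/-- The Riesz isomorphism `(ℝⁿ)* → ℝⁿ`, in coordinates. -/
noncomputable def rieszCLM (n : ℕ) : (E n →L[ℝ] ℝ) →L[ℝ] E n :=
  ∑ i, (ContinuousLinearMap.apply ℝ ℝ (EuclideanSpace.single i (1 : ℝ) : E n)).smulRight
    (EuclideanSpace.single i (1 : ℝ))

lemma inner_rieszCLM {n : ℕ} (l : E n →L[ℝ] ℝ) (v : E n) : inner ℝ (rieszCLM n l) v = l v := by
  have hv : v = ∑ i, v i • (EuclideanSpace.single i (1 : ℝ) : E n) := by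
    ext j
    simp [Finset.sum_apply, Pi.single_apply]
  conv_rhs => rw [hv]
  simp [rieszCLM, sum_inner, inner_smul_left, EuclideanSpace.inner_single_left, mul_comm]

/-- The gradient map `Du`, with values in `ℝⁿ`. -/
noncomputable def gradMap {n : ℕ} (u : E n → ℝ) (x : E n) : E n := rieszCLM n (fderiv ℝ u x)

lemma inner_gradMap {n : ℕ} (u : E n → ℝ) (x v : E n) :
    inner ℝ (gradMap u x) v = fderiv ℝ u x v :=
  inner_rieszCLM _ _

/-- The Hessian as an endomorphism of `ℝⁿ`. -/
noncomputable def hessCLM {n : ℕ} (u : E n → ℝ) (x : E n) : E n →L[ℝ] E n :=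
  rieszCLM n ∘L fderiv ℝ (fderiv ℝ u) x

lemma inner_hessCLM {n : ℕ} (u : E n → ℝ) (x v w : E n) :
    inner ℝ (hessCLM u x v) w = fderiv ℝ (fderiv ℝ u) x v w :=
  inner_rieszCLM _ _

lemma contDiffAt_gradMap {n : ℕ} {u : E n → ℝ} {x : E n} (hu : ContDiffAt ℝ 2 u x) :
    ContDiffAt ℝ 1 (gradMap u) x :=
  (rieszCLM n).contDiff.contDiffAt.comp x (hu.fderiv_right (m := 1) (by norm_num))

lemma hasFDerivAt_gradMap {n : ℕ} {u : E n → ℝ} {x : E n} (hu : ContDiffAt ℝ 2 u x) :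
    HasFDerivAt (gradMap u) (hessCLM u x) x :=
  (rieszCLM n).hasFDerivAt.comp x
    ((hu.fderiv_right (m := 1) (by norm_num)).differentiableAt (by norm_num)).hasFDerivAt

lemma hasStrictFDerivAt_gradMap {n : ℕ} {u : E n → ℝ} {x : E n} (hu : ContDiffAt ℝ 2 u x) :
    HasStrictFDerivAt (gradMap u) (hessCLM u x) x := by
  have h := (contDiffAt_gradMap hu).hasStrictFDerivAt (by norm_num)
  rwa [(hasFDerivAt_gradMap hu).fderiv] at h

lemma Hess_apply {n : ℕ} (u : E n → ℝ) (x : E n) (i j : Fin n) :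
    Hess u x i j =
      inner ℝ (hessCLM u x (EuclideanSpace.single i 1)) (EuclideanSpace.single j 1) := by
  rw [inner_hessCLM, Hess, iteratedFDeriv_two_apply]
  simp

lemma det_hessCLM {n : ℕ} (u : E n → ℝ) (x : E n) : (hessCLM u x).det = (Hess u x).det := by
  have h : LinearMap.toMatrix (EuclideanSpace.basisFun (Fin n) ℝ).toBasis
      (EuclideanSpace.basisFun (Fin n) ℝ).toBasis (hessCLM u x : E n →ₗ[ℝ] E n) =
      (Hess u x).transpose := by
    ext i j
    simp [LinearMap.toMatrix_apply, Hess_apply, EuclideanSpace.inner_single_right]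
  rw [ContinuousLinearMap.det, ← LinearMap.det_toMatrix
    (EuclideanSpace.basisFun (Fin n) ℝ).toBasis, h, Matrix.det_transpose]

lemma sum_Hess_mul_mul {n : ℕ} (u : E n → ℝ) (x v : E n) :
    ∑ i, ∑ j, Hess u x i j * v i * v j = inner ℝ (hessCLM u x v) v := by
  have hv : v = ∑ i, v i • (EuclideanSpace.single i (1 : ℝ) : E n) := by
    ext j
    simp [Finset.sum_apply, Pi.single_apply]
  conv_rhs => rw [hv]
  simp only [map_sum, sum_inner, inner_sum, map_smul, inner_smul_left, inner_smul_right,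
    Hess_apply, Finset.mul_sum]
  rw [Finset.sum_comm]
  refine Finset.sum_congr rfl fun i _ => Finset.sum_congr rfl fun j _ => ?_
  simp only [conj_trivial]
  ring

lemma inner_hessCLM_pos {n : ℕ} {u : E n → ℝ} {x : E n} (h : (Hess u x).PosDef) {v : E n}
    (hv : v ≠ 0) : 0 < inner ℝ (hessCLM u x v) v := by
  rw [← sum_Hess_mul_mul]
  have h0 : (v : Fin n → ℝ) ≠ 0 := fun h => hv (by ext i; exact congrFun h i)
  have := h.dotProduct_mulVec_pos h0
  simp only [dotProduct, Matrix.mulVec, Finset.mul_sum, star_trivial] at this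
  refine this.trans_eq (Finset.sum_congr rfl fun i _ => Finset.sum_congr rfl fun j _ => ?_)
  ring

lemma hessCLM_det_pos {n : ℕ} {u : E n → ℝ} {x : E n} (h : (Hess u x).PosDef) :
    0 < (hessCLM u x).det := by
  rw [det_hessCLM]; exact h.det_pos

section Convexity

variable {n : ℕ} {Ω : Set (E n)} {u : E n → ℝ}

lemma strictMonoOn_fderiv_segment (hΩc : Convex ℝ Ω) (hu : ∀ x ∈ Ω, ContDiffAt ℝ 2 u x)
    (hconv : ∀ x ∈ Ω, (Hess u x).PosDef) {x z : E n} (hx : x ∈ Ω) (hz : z ∈ Ω) (hxz : x ≠ z) :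
    StrictMonoOn (fun s : ℝ => fderiv ℝ u (x + s • (z - x)) (z - x)) (Icc 0 1) := by
  have hmem : ∀ s ∈ Icc (0 : ℝ) 1, x + s • (z - x) ∈ Ω := fun s hs =>
    hΩc.add_smul_sub_mem hx hz hs
  have hd : ∀ s ∈ Icc (0 : ℝ) 1,
      HasDerivAt (fun s : ℝ => fderiv ℝ u (x + s • (z - x)) (z - x))
        (inner ℝ (hessCLM u (x + s • (z - x)) (z - x)) (z - x)) s := by
    intro s hs
    have h1 : HasDerivAt (fun s : ℝ => x + s • (z - x)) (z - x) s := by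
      simpa using ((hasDerivAt_id s).smul_const (z - x)).const_add x
    have h2 := ((hasFDerivAt_gradMap (hu _ (hmem s hs))).comp_hasDerivAt s h1).inner ℝ
      (hasDerivAt_const s (z - x))
    simpa [inner_gradMap] using h2
  refine strictMonoOn_of_deriv_pos (convex_Icc 0 1)
    (fun s hs => (hd s hs).continuousAt.continuousWithinAt) fun s hs => ?_
  rw [interior_Icc] at hs
  have hs' := Ioo_subset_Icc_self hs
  rw [(hd s hs').deriv]
  exact inner_hessCLM_pos (hconv _ (hmem s hs')) (sub_ne_zero.2 hxz.symm)

lemma injOn_gradMap (hΩc : Convex ℝ Ω) (hu : ∀ x ∈ Ω, ContDiffAt ℝ 2 u x)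
    (hconv : ∀ x ∈ Ω, (Hess u x).PosDef) : InjOn (gradMap u) Ω := by
  intro x hx z hz h
  by_contra hxz
  have := strictMonoOn_fderiv_segment hΩc hu hconv hx hz hxz
    (left_mem_Icc.2 zero_le_one) (right_mem_Icc.2 zero_le_one) zero_lt_one
  simp only [← inner_gradMap, zero_smul, add_zero, one_smul, add_sub_cancel, h, lt_self_iff_false]
    at this

lemma add_fderiv_le (hΩc : Convex ℝ Ω) (hu : ∀ x ∈ Ω, ContDiffAt ℝ 2 u x)
    (hconv : ∀ x ∈ Ω, (Hess u x).PosDef) {x z : E n} (hx : x ∈ Ω) (hz : z ∈ Ω) :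
    u x + inner ℝ (gradMap u x) (z - x) ≤ u z := by
  rcases eq_or_ne x z with rfl | hxz
  · simp
  have hd : ∀ s ∈ Icc (0 : ℝ) 1, HasDerivAt (fun s : ℝ => u (x + s • (z - x)))
      (fderiv ℝ u (x + s • (z - x)) (z - x)) s := by
    intro s hs
    have h1 : HasDerivAt (fun s : ℝ => x + s • (z - x)) (z - x) s := by
      simpa using ((hasDerivAt_id s).smul_const (z - x)).const_add x
    exact ((hu _ (hΩc.add_smul_sub_mem hx hz hs)).differentiableAt
      (by norm_num)).hasFDerivAt.comp_hasDerivAt s h1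
  obtain ⟨s, hs, h⟩ := exists_hasDerivAt_eq_slope (fun s : ℝ => u (x + s • (z - x)))
    (fun s => fderiv ℝ u (x + s • (z - x)) (z - x)) zero_lt_one
    (fun s hs => (hd s hs).continuousAt.continuousWithinAt)
    (fun s hs => hd s (Ioo_subset_Icc_self hs))
  have := strictMonoOn_fderiv_segment hΩc hu hconv hx hz hxz
    (left_mem_Icc.2 zero_le_one) (Ioo_subset_Icc_self hs) hs.1
  simp only [zero_smul, add_zero, one_smul, add_sub_cancel, sub_zero, div_one] at this h
  rw [inner_gradMap]
  linarith

/-- The gradient map as a homeomorphism onto its image. -/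
lemma exists_openPartialHomeomorph_gradMap (hΩo : IsOpen Ω) (hΩc : Convex ℝ Ω)
    (hu : ∀ x ∈ Ω, ContDiffAt ℝ 2 u x) (hconv : ∀ x ∈ Ω, (Hess u x).PosDef) :
    ∃ e : OpenPartialHomeomorph (E n) (E n), e.source = Ω ∧ ⇑e = gradMap u := by
  let p := (injOn_gradMap hΩc hu hconv).toPartialEquiv
  have hc : ContinuousOn p p.source := fun x hx =>
    (contDiffAt_gradMap (hu x hx)).continuousAt.continuousWithinAt
  have ho : IsOpenMap (p.source.domRestrict p) := by
    refine IsOpenMap.of_nhds_le fun x => ?_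
    have h := (hasStrictFDerivAt_gradMap (hu x.1 x.2))
    have h' : HasStrictFDerivAt (gradMap u) (((hessCLM u x.1).toContinuousLinearEquivOfDetNeZero
        (hessCLM_det_pos (hconv x.1 x.2)).ne' : E n ≃L[ℝ] E n) : E n →L[ℝ] E n) x.1 := by
      simpa using h
    have h2 := h'.map_nhds_eq_of_equiv
    change 𝓝 (gradMap u x.1) ≤ _
    rw [← h2, ← hΩo.nhdsWithin_eq x.2, ← map_nhds_subtype_val (s := Ω) ⟨x.1, x.2⟩,
      Filter.map_map]
    exact le_rfl
  exact ⟨.ofContinuousOpenRestrict p hc ho hΩo, rfl, rfl⟩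

end Convexity

section Tube

variable {n : ℕ} {Ω : Set (E n)} {u : E n → ℝ}

/-- A strictly convex function grows at least linearly relative to its tangent plane at `p`. -/
lemma exists_linear_growth (hΩo : IsOpen Ω) (hΩc : Convex ℝ Ω)
    (hu : ∀ x ∈ Ω, ContDiffAt ℝ 2 u x) (hconv : ∀ x ∈ Ω, (Hess u x).PosDef) {p : E n}
    (hp : p ∈ Ω) :
    ∃ c > 0, ∃ C, Metric.ball (gradMap u p) c ⊆ gradMap u '' Ω ∧
      ∀ x ∈ Ω, inner ℝ (gradMap u p) (x - p) + c * ‖x - p‖ - C ≤ u x := by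
  obtain ⟨e, he, he'⟩ := exists_openPartialHomeomorph_gradMap hΩo hΩc hu hconv
  obtain ⟨ρ, hρ, hρΩ⟩ := Metric.nhds_basis_closedBall.mem_iff.1 (hΩo.mem_nhds hp)
  have h1 : gradMap u '' Metric.closedBall p ρ ∈ 𝓝 (gradMap u p) := by
    rw [← he', ← e.map_nhds_eq (he ▸ hp)]
    exact image_mem_map (Metric.closedBall_mem_nhds p hρ)
  obtain ⟨c, hc, hcG⟩ := Metric.nhds_basis_closedBall.mem_iff.1 h1
  have hcont : ContinuousOn u (Metric.closedBall p ρ) := fun x hx =>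
    (hu x (hρΩ hx)).continuousAt.continuousWithinAt
  obtain ⟨m, hm⟩ := ((isCompact_closedBall p ρ).image_of_continuousOn hcont).bddBelow
  refine ⟨c, hc, (‖gradMap u p‖ + c) * ρ - m,
    (Metric.ball_subset_closedBall.trans hcG).trans (image_mono hρΩ), fun x hx => ?_⟩
  obtain ⟨v, hv, hvx⟩ : ∃ v : E n, ‖v‖ ≤ 1 ∧ inner ℝ v (x - p) = ‖x - p‖ := by
    rcases eq_or_ne (x - p) 0 with h | h
    · exact ⟨0, by simp, by simp [h]⟩
    · refine ⟨‖x - p‖⁻¹ • (x - p), by simp [norm_smul, h], ?_⟩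
      rw [real_inner_smul_left, real_inner_self_eq_norm_sq]
      field_simp [norm_ne_zero_iff.2 h]
  obtain ⟨q, hq, hqv⟩ := hcG (show gradMap u p + c • v ∈ Metric.closedBall (gradMap u p) c by
    rw [mem_closedBall_iff_norm]
    simpa [norm_smul, abs_of_pos hc] using mul_le_mul_of_nonneg_left hv hc.le)
  have h2 := add_fderiv_le hΩc hu hconv (hρΩ hq) hx
  have h3 : m ≤ u q := hm (mem_image_of_mem u hq)
  have h4 : x - q = (x - p) + (p - q) := by abel
  rw [hqv, h4, inner_add_right, inner_add_left, real_inner_smul_left, hvx] at h2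
  have h5 := neg_le_of_abs_le (abs_real_inner_le_norm (gradMap u p + c • v) (p - q))
  have h6 : ‖gradMap u p + c • v‖ * ‖p - q‖ ≤ (‖gradMap u p‖ + c) * ρ := by
    refine mul_le_mul ((norm_add_le _ _).trans ?_) ?_ (norm_nonneg _) (by positivity)
    · simpa [norm_smul, abs_of_pos hc] using mul_le_mul_of_nonneg_left hv hc.le
    · simpa [dist_eq_norm, norm_sub_rev] using hq
  linarith

/-- If `u` has a supporting bound at `x₀` and `ν` is an outer normal there, then the points whose
gradients lie in a thin tube in direction `ν` remain bounded, and so do the values of `u`. -/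
lemma exists_bounded_tube (hΩo : IsOpen Ω) (hΩc : Convex ℝ Ω)
    (hu : ∀ x ∈ Ω, ContDiffAt ℝ 2 u x) (hconv : ∀ x ∈ Ω, (Hess u x).PosDef) {p : E n}
    (hp : p ∈ Ω) {x₀ ν : E n} {L : ℝ}
    (hL : ∀ x ∈ Ω, u x + inner ℝ (gradMap u x) (x₀ - x) ≤ L)
    (hν : ∀ x ∈ Ω, 0 ≤ inner ℝ ν (x₀ - x)) :
    ∃ r > 0, ∃ R B, Metric.ball (gradMap u p) r ⊆ gradMap u '' Ω ∧
      ∀ x ∈ Ω, ∀ y ∈ Metric.ball (gradMap u p) r, ∀ t : ℝ, 0 ≤ t → gradMap u x = y + t • ν →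
        ‖x‖ ≤ R ∧ |u x| ≤ B := by
  obtain ⟨c, hc, C, hball, hgrow⟩ := exists_linear_growth hΩo hΩc hu hconv hp
  set g := gradMap u p
  set D := ‖x₀ - p‖
  set R := (L + C + ‖g‖ * D + c / 2 * D) / (c / 2) with hR
  refine ⟨c / 2, by positivity, ‖p‖ + R,
    max (L + (‖g‖ + c / 2) * (D + R)) (C + ‖g‖ * R),
    (Metric.ball_subset_ball (by linarith)).trans hball, fun x hx y hy t ht hxy => ?_⟩
  have h1 := hL x hx
  rw [hxy, inner_add_left, real_inner_smul_left] at h1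
  have h2 := mul_nonneg ht (hν x hx)
  have h3 := hgrow x hx
  have hy' : ‖y - g‖ ≤ c / 2 := (mem_ball_iff_norm.1 hy).le
  have h4 : inner ℝ y (x₀ - x) = inner ℝ g (x₀ - p) - inner ℝ g (x - p) +
      inner ℝ (y - g) (x₀ - p) - inner ℝ (y - g) (x - p) := by
    simp only [inner_sub_left, inner_sub_right]; ring
  have h5 := neg_le_of_abs_le (abs_real_inner_le_norm g (x₀ - p))
  have h6 := neg_le_of_abs_le (abs_real_inner_le_norm (y - g) (x₀ - p))
  have h7 := le_of_abs_le (abs_real_inner_le_norm (y - g) (x - p))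
  have h8 : ‖y - g‖ * ‖x₀ - p‖ ≤ c / 2 * D := mul_le_mul_of_nonneg_right hy' (norm_nonneg _)
  have h9 : ‖y - g‖ * ‖x - p‖ ≤ c / 2 * ‖x - p‖ := mul_le_mul_of_nonneg_right hy' (norm_nonneg _)
  have hxR : ‖x - p‖ ≤ R := by
    rw [hR, le_div_iff₀ (by positivity)]
    linarith
  have h10 := neg_le_of_abs_le (abs_real_inner_le_norm g (x - p))
  have h11 : ‖g‖ * ‖x - p‖ ≤ ‖g‖ * R := mul_le_mul_of_nonneg_left hxR (norm_nonneg _)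
  have h12 := neg_le_of_abs_le (abs_real_inner_le_norm y (x₀ - x))
  have h13 : ‖y‖ ≤ ‖g‖ + c / 2 := by
    have := norm_add_le g (y - g)
    rw [add_sub_cancel] at this
    linarith
  have h14 : ‖x₀ - x‖ ≤ D + R := by
    have := norm_sub_le (x₀ - p) (x - p)
    rw [sub_sub_sub_cancel_right] at this
    linarith
  have h15 : ‖y‖ * ‖x₀ - x‖ ≤ (‖g‖ + c / 2) * (D + R) :=
    mul_le_mul h13 h14 (norm_nonneg _) (by positivity)
  refine ⟨?_, abs_le.2 ⟨?_, ?_⟩⟩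
  · have := norm_add_le p (x - p)
    rw [add_sub_cancel] at this
    linarith
  · have := le_max_right (L + (‖g‖ + c / 2) * (D + R)) (C + ‖g‖ * R)
    have := mul_nonneg hc.le (norm_nonneg (x - p))
    linarith
  · have := le_max_left (L + (‖g‖ + c / 2) * (D + R)) (C + ‖g‖ * R)
    linarith

end Tube

section FiniteLength

/-- A `C¹` curve on `[0, 1)` of finite length is bounded. -/
lemma exists_norm_le_of_lintegral_derivWithin_ne_top {F : Type*} [NormedAddCommGroup F]
    [NormedSpace ℝ F] [CompleteSpace F] {f : ℝ → F} (hf : ContDiffOn ℝ 1 f (Ico 0 1))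
    (hfin : ∫⁻ t in Ico (0 : ℝ) 1, ‖derivWithin f (Ico 0 1) t‖ₑ ≠ ⊤) :
    ∃ C, ∀ t ∈ Ico (0 : ℝ) 1, ‖f t‖ ≤ C := by
  refine ⟨‖f 0‖ + (∫⁻ t in Ico (0 : ℝ) 1, ‖derivWithin f (Ico 0 1) t‖ₑ).toReal, fun t ht => ?_⟩
  have h : ‖f t - f 0‖ₑ ≤ ∫⁻ s in Ico (0 : ℝ) 1, ‖derivWithin f (Ico 0 1) s‖ₑ := by
    refine (enorm_sub_le_lintegral_deriv_of_contDiffOn_Icc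
      (hf.mono (Icc_subset_Ico_right ht.2)) ht.1).trans ?_
    rw [← restrict_Ioo_eq_restrict_Icc]
    calc ∫⁻ s in Ioo 0 t, ‖deriv f s‖ₑ
        = ∫⁻ s in Ioo 0 t, ‖derivWithin f (Ico 0 1) s‖ₑ := by
          refine setLIntegral_congr_fun measurableSet_Ioo fun s hs => ?_
          rw [derivWithin_of_mem_nhds (Ico_mem_nhds hs.1 (hs.2.trans ht.2))]
      _ ≤ ∫⁻ s in Ico (0 : ℝ) 1, ‖derivWithin f (Ico 0 1) s‖ₑ :=
          lintegral_mono_set fun s hs => ⟨hs.1.le, hs.2.trans ht.2⟩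
  have h' := ENNReal.toReal_mono hfin h
  rw [toReal_enorm] at h'
  linarith [norm_le_norm_add_norm_sub' (f t) (f 0)]

variable {n : ℕ} {Ω : Set (E n)} {u : E n → ℝ}

/-- A divergent curve of finite Euclidean length accumulates at a boundary point of `Ω` where all
tangent planes of `u` are bounded by a common constant. -/
lemma exists_boundary_point (hΩo : IsOpen Ω) (hΩc : Convex ℝ Ω)
    (hu : ∀ x ∈ Ω, ContDiffAt ℝ 2 u x) (hconv : ∀ x ∈ Ω, (Hess u x).PosDef)
    {γ : ℝ → E n} (hγ : IsDivergentCurve Ω γ)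
    (hfin : ∫⁻ t in Set.Ico (0 : ℝ) 1, ENNReal.ofReal
      (Real.sqrt (‖curveDeriv γ t‖ ^ 2 + (fderiv ℝ u (γ t) (curveDeriv γ t)) ^ 2)) ≠ ⊤) :
    ∃ x₀ ∉ Ω, ∃ L, ∀ x ∈ Ω, u x + inner ℝ (gradMap u x) (x₀ - x) ≤ L := by
  obtain ⟨hγ1, hγΩ, hγK⟩ := hγ
  have hle1 : ∀ t, ‖derivWithin γ (Ico 0 1) t‖ₑ ≤ ENNReal.ofReal
      (Real.sqrt (‖curveDeriv γ t‖ ^ 2 + (fderiv ℝ u (γ t) (curveDeriv γ t)) ^ 2)) := by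
    intro t
    rw [← ofReal_norm]
    exact ENNReal.ofReal_le_ofReal (Real.le_sqrt_of_sq_le (le_add_of_nonneg_right (sq_nonneg _)))
  obtain ⟨A, hA⟩ := exists_norm_le_of_lintegral_derivWithin_ne_top hγ1
    (ne_top_of_le_ne_top hfin (lintegral_mono hle1))
  have hu1 : ContDiffOn ℝ 1 (fun t => u (γ t)) (Ico 0 1) := fun t ht =>
    (((hu _ (hγΩ t ht)).of_le (by norm_num)).contDiffWithinAt (s := univ)).comp t (hγ1 t ht)
      (mapsTo_univ _ _)
  have hle2 : ∀ t ∈ Ico (0 : ℝ) 1, ‖derivWithin (fun t => u (γ t)) (Ico 0 1) t‖ₑ ≤ ENNReal.ofReal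
      (Real.sqrt (‖curveDeriv γ t‖ ^ 2 + (fderiv ℝ u (γ t) (curveDeriv γ t)) ^ 2)) := by
    intro t ht
    have hd : HasDerivWithinAt (fun t => u (γ t)) (fderiv ℝ u (γ t) (curveDeriv γ t))
        (Ico 0 1) t :=
      ((hu _ (hγΩ t ht)).differentiableAt (by norm_num)).hasFDerivAt.comp_hasDerivWithinAt t
        ((hγ1 t ht).differentiableWithinAt (by norm_num)).hasDerivWithinAt
    rw [hd.derivWithin (uniqueDiffOn_Ico 0 1 t ht), ← ofReal_norm]
    refine ENNReal.ofReal_le_ofReal (Real.le_sqrt_of_sq_le ?_)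
    rw [Real.norm_eq_abs, sq_abs]
    exact le_add_of_nonneg_left (sq_nonneg _)
  obtain ⟨L, hL⟩ := exists_norm_le_of_lintegral_derivWithin_ne_top hu1
    (ne_top_of_le_ne_top hfin (setLIntegral_mono' measurableSet_Ico hle2))
  have hIco : ∀ᶠ t in 𝓝[<] (1 : ℝ), t ∈ Ico (0 : ℝ) 1 := Ico_mem_nhdsLT zero_lt_one
  obtain ⟨x₀, -, hx₀⟩ := (isCompact_closedBall (0 : E n) A).exists_mapClusterPt
    (f := 𝓝[<] (1 : ℝ)) (u := γ) (by
      refine tendsto_principal.2 ?_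
      filter_upwards [hIco] with t ht using by simpa using hA t ht)
  refine ⟨x₀, fun hx₀Ω => ?_, L, fun x hx => ?_⟩
  · obtain ⟨ρ, hρ, hρΩ⟩ := Metric.nhds_basis_closedBall.mem_iff.1 (hΩo.mem_nhds hx₀Ω)
    obtain ⟨t₀, ht₀, h⟩ := hγK _ hρΩ (isCompact_closedBall x₀ ρ)
    obtain ⟨t, ht, ht'⟩ := ((hx₀.frequently (Metric.closedBall_mem_nhds x₀ hρ)).and_eventually
      (Ioo_mem_nhdsLT ht₀.2)).exists
    exact h t ht'.1 ht'.2 ht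
  · have hclosed : IsClosed {z : E n | u x + inner ℝ (gradMap u x) (z - x) ≤ L} :=
      isClosed_le (by fun_prop) continuous_const
    refine hclosed.mem_of_mapClusterPt hx₀ ?_
    filter_upwards [hIco] with t ht
    exact (add_fderiv_le hΩc hu hconv hx (hγΩ t ht)).trans (le_of_abs_le (hL t ht))

end FiniteLength

/-- Averaging over parallel lines: the integrals of `J` along the lines in direction `ν` starting in
a ball of radius `r` have total mass at most `2 r ∫ J`. -/
lemma lintegral_ball_lintegral_line_le {n : ℕ} {J : E n → ENNReal} (hJ : Measurable J) {ν : E n}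
    (hν : ‖ν‖ = 1) (y₀ : E n) (r : ℝ) :
    ∫⁻ y in Metric.ball y₀ r, ∫⁻ t : ℝ, J (y + t • ν) ≤ ENNReal.ofReal (2 * r) * ∫⁻ z, J z := by
  set I : E n → ENNReal := (Metric.ball y₀ r).indicator 1 with hI
  have hIm : Measurable I := measurable_one.indicator measurableSet_ball
  calc ∫⁻ y in Metric.ball y₀ r, ∫⁻ t : ℝ, J (y + t • ν)
      = ∫⁻ y, ∫⁻ t : ℝ, I y * J (y + t • ν) := by
        rw [← lintegral_indicator measurableSet_ball]
        refine lintegral_congr fun y => ?_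
        rw [lintegral_const_mul _ (by fun_prop)]
        by_cases hy : y ∈ Metric.ball y₀ r <;> simp [hI, hy]
    _ = ∫⁻ t : ℝ, ∫⁻ y, I y * J (y + t • ν) := by
        refine lintegral_lintegral_swap (Measurable.aemeasurable ?_)
        simp only [Function.uncurry_def]
        fun_prop
    _ = ∫⁻ t : ℝ, ∫⁻ z, I (z - t • ν) * J z := by
        refine lintegral_congr fun t => ?_
        rw [← lintegral_add_right_eq_self (fun z => I (z - t • ν) * J z) (t • ν)]
        simp
    _ = ∫⁻ z, ∫⁻ t : ℝ, I (z - t • ν) * J z := by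
        refine lintegral_lintegral_swap (Measurable.aemeasurable ?_)
        simp only [Function.uncurry_def]
        fun_prop
    _ ≤ ∫⁻ z, ENNReal.ofReal (2 * r) * J z := by
        refine lintegral_mono fun z => ?_
        rw [lintegral_mul_const _ (by fun_prop)]
        gcongr
        calc ∫⁻ t : ℝ, I (z - t • ν)
            ≤ ∫⁻ t : ℝ, (Metric.ball (inner ℝ (z - y₀) ν) r).indicator 1 t := by
              refine lintegral_mono fun t => ?_
              by_cases ht : z - t • ν ∈ Metric.ball y₀ r
              · have : t ∈ Metric.ball (inner ℝ (z - y₀) ν) r := by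
                  rw [mem_ball_iff_norm] at ht ⊢
                  refine lt_of_le_of_lt ?_ ht
                  have h := abs_real_inner_le_norm (z - t • ν - y₀) ν
                  rw [hν, mul_one] at h
                  refine le_trans (le_of_eq ?_) h
                  rw [sub_right_comm, inner_sub_left (z - y₀), real_inner_smul_left,
                    real_inner_self_eq_norm_sq, hν, Real.norm_eq_abs, abs_sub_comm]
                  simp
                simp [this, hI, ht]
              · simp [hI, ht]
          _ = ENNReal.ofReal (2 * r) := by
              rw [lintegral_indicator_one measurableSet_ball, Real.volume_ball]
    _ = _ := lintegral_const_mul _ hJ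

section RayTime

/-- The time change `τ ↦ τ / (1 - τ + κ τ)`, mapping `[0, 1)` onto `[0, 1 / κ)` if `κ > 0` and onto
`[0, ∞)` if `κ = 0`. -/
def rayTime (κ τ : ℝ) : ℝ := τ / (1 - τ + κ * τ)

variable {κ τ : ℝ}

lemma rayTime_den_pos (hκ : 0 ≤ κ) (hτ : τ ∈ Ico (0 : ℝ) 1) : 0 < 1 - τ + κ * τ :=
  add_pos_of_pos_of_nonneg (sub_pos.2 hτ.2) (mul_nonneg hκ hτ.1)

lemma rayTime_nonneg (hκ : 0 ≤ κ) (hτ : τ ∈ Ico (0 : ℝ) 1) : 0 ≤ rayTime κ τ :=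
  div_nonneg hτ.1 (rayTime_den_pos hκ hτ).le

lemma contDiffAt_rayTime (h : 1 - τ + κ * τ ≠ 0) {m : WithTop ℕ∞} :
    ContDiffAt ℝ m (rayTime κ) τ :=
  contDiffAt_id.div ((contDiffAt_const.sub contDiffAt_id).add (contDiffAt_const.mul contDiffAt_id))
    h

lemma hasDerivAt_rayTime (h : 1 - τ + κ * τ ≠ 0) :
    HasDerivAt (rayTime κ) (1 / (1 - τ + κ * τ) ^ 2) τ := by
  have h1 : HasDerivAt (fun τ : ℝ => 1 - τ + κ * τ) (-1 + κ * 1) τ :=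
    ((hasDerivAt_id τ).const_sub 1).add ((hasDerivAt_id τ).const_mul κ)
  refine ((hasDerivAt_id τ).div h1 h).congr_deriv ?_
  simp only [id]
  congr 1
  ring

lemma injOn_rayTime (hκ : 0 ≤ κ) : InjOn (rayTime κ) (Ico 0 1) := by
  intro s hs t ht h
  rw [rayTime, rayTime, div_eq_div_iff (rayTime_den_pos hκ hs).ne'
    (rayTime_den_pos hκ ht).ne'] at h
  linarith

/-- A ray starting in an open set can be parametrised on `[0, 1)` so that it leaves every compact
subset of that set. -/
lemma exists_rayTime_mem_and_divergent {n : ℕ} {U : Set (E n)} (hU : IsOpen U) {y ν : E n}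
    (hy : y ∈ U) (hν : ‖ν‖ = 1) :
    ∃ κ : ℝ, 0 ≤ κ ∧ (∀ τ ∈ Ico (0 : ℝ) 1, y + rayTime κ τ • ν ∈ U) ∧
      ∀ K ⊆ U, IsCompact K →
        ∃ t₀ ∈ Ico (0 : ℝ) 1, ∀ τ, t₀ < τ → τ < 1 → y + rayTime κ τ • ν ∉ K := by
  set A : Set ℝ := Ici 0 ∩ (fun t : ℝ => y + t • ν) ⁻¹' Uᶜ with hA
  have hAc : IsClosed A := isClosed_Ici.inter (hU.isClosed_compl.preimage (by fun_prop))
  rcases A.eq_empty_or_nonempty with hA0 | hA0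
  · have hmem : ∀ t : ℝ, 0 ≤ t → y + t • ν ∈ U := fun t ht => by
      by_contra h
      exact (hA0 ▸ (⟨ht, h⟩ : t ∈ A) : t ∈ (∅ : Set ℝ))
    refine ⟨0, le_rfl, fun τ hτ => hmem _ (rayTime_nonneg le_rfl hτ), fun K _ hK => ?_⟩
    obtain ⟨M, hM⟩ := hK.isBounded.exists_norm_le
    set N := |M| + ‖y‖ with hN
    have hN0 : 0 ≤ N := by positivity
    refine ⟨N / (1 + N), ⟨by positivity, (div_lt_one (by positivity)).2 (by linarith)⟩,
      fun τ h1 h2 hK => ?_⟩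
    have h3 : N < rayTime 0 τ := by
      rw [div_lt_iff₀ (by positivity)] at h1
      rw [rayTime, zero_mul, add_zero, lt_div_iff₀ (by linarith)]
      linarith
    have h4 := (hM _ hK).trans (le_abs_self M)
    have h5 := norm_sub_le (y + rayTime 0 τ • ν) y
    rw [add_sub_cancel_left, norm_smul, hν, mul_one] at h5
    linarith [Real.le_norm_self (rayTime 0 τ)]
  · have hbdd : BddBelow A := ⟨0, fun t ht => ht.1⟩
    obtain ⟨hT0, hTU⟩ := hAc.csInf_mem hA0 hbdd
    set T := sInf A
    have hT : 0 < T := lt_of_le_of_ne hT0 fun h => hTU (by simpa [← h] using hy)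
    have hκ : 0 ≤ 1 / T := by positivity
    refine ⟨1 / T, hκ, fun τ hτ => ?_, fun K hKU hK => ?_⟩
    · by_contra h
      have h1 : T ≤ rayTime (1 / T) τ := csInf_le hbdd ⟨rayTime_nonneg hκ hτ, h⟩
      rw [rayTime, le_div_iff₀ (rayTime_den_pos hκ hτ)] at h1
      have h2 : T * (1 - τ + 1 / T * τ) = T * (1 - τ) + τ := by field_simp
      nlinarith [mul_pos hT (sub_pos.2 hτ.2)]
    · have hval : rayTime (1 / T) 1 = T := by simp [rayTime]
      have hcont : ContinuousAt (fun τ => y + rayTime (1 / T) τ • ν) 1 :=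
        continuousAt_const.add (((contDiffAt_rayTime (m := 1)
          (by simpa using hT.ne')).continuousAt).smul continuousAt_const)
      have hev : ∀ᶠ τ in 𝓝[<] (1 : ℝ), y + rayTime (1 / T) τ • ν ∈ Kᶜ := by
        refine (hcont.eventually_mem (hK.isClosed.isOpen_compl.mem_nhds ?_)).filter_mono
          nhdsWithin_le_nhds
        simp only [hval]
        exact fun h => hTU (hKU h)
      obtain ⟨l, hl, h⟩ := (mem_nhdsLT_iff_exists_Ioo_subset' (show (0 : ℝ) < 1 by norm_num)).1 hev
      exact ⟨max l 0, ⟨le_max_right _ _, max_lt hl zero_lt_one⟩,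
        fun τ h1 h2 => h ⟨(le_max_left _ _).trans_lt h1, h2⟩⟩

end RayTime

/-- The weighted arithmetic–geometric mean bound for the affine length element along a ray of
gradients. -/
lemma rpow_mul_sqrt_le (n : ℕ) {a d t : ℝ} (ha : 0 ≤ a) (hd : 0 < d) (ht : 0 ≤ t) :
    d ^ (-(1 : ℝ) / (2 * (n + 2))) * Real.sqrt a ≤
      (1 + t) * a + (d⁻¹ + (1 + t) ^ (-((n + 2 : ℝ) / (n + 1)))) := by
  have ht1 : 0 < 1 + t := by linarith
  have hw : (1 / 2 : ℝ) + 1 / (2 * (n + 2)) + (n + 1) / (2 * (n + 2)) = 1 := by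
    field_simp; ring
  have hw2 : (1 : ℝ) / (2 * (n + 2)) ≤ 1 := by
    have : (0 : ℝ) ≤ (n + 1) / (2 * (n + 2)) := by positivity
    linarith
  have hw3 : ((n : ℝ) + 1) / (2 * (n + 2)) ≤ 1 := by
    have : (0 : ℝ) ≤ 1 / (2 * (n + 2)) := by positivity
    linarith
  have key := Real.geom_mean_le_arith_mean3_weighted (by norm_num : (0 : ℝ) ≤ 1 / 2)
    (by positivity : (0 : ℝ) ≤ 1 / (2 * (n + 2)))
    (by positivity : (0 : ℝ) ≤ (n + 1) / (2 * (n + 2)))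
    (mul_nonneg ht1.le ha) (inv_nonneg.2 hd.le)
    (Real.rpow_nonneg ht1.le (-((n + 2 : ℝ) / (n + 1)))) hw
  have e1 : ((1 + t) ^ (-((n + 2 : ℝ) / (n + 1)))) ^ ((n + 1 : ℝ) / (2 * (n + 2))) =
      (1 + t) ^ (-(1 / 2) : ℝ) := by
    rw [← Real.rpow_mul ht1.le]
    congr 1
    field_simp
  have e2 : (d⁻¹) ^ ((1 : ℝ) / (2 * (n + 2))) = d ^ (-(1 : ℝ) / (2 * (n + 2))) := by
    rw [Real.inv_rpow hd.le, ← Real.rpow_neg hd.le, neg_div]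
  rw [e1, e2, Real.mul_rpow ht1.le ha, ← Real.sqrt_eq_rpow a] at key
  have e3 : (1 + t) ^ (1 / 2 : ℝ) * (1 + t) ^ (-(1 / 2) : ℝ) = 1 := by
    rw [← Real.rpow_add ht1]; simp
  calc d ^ (-(1 : ℝ) / (2 * (n + 2))) * Real.sqrt a
      = (1 + t) ^ (1 / 2 : ℝ) * Real.sqrt a * d ^ (-(1 : ℝ) / (2 * (n + 2))) *
          (1 + t) ^ (-(1 / 2) : ℝ) := by
        linear_combination (-(d ^ (-(1 : ℝ) / (2 * (n + 2))) * Real.sqrt a)) * e3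
    _ ≤ _ := key
    _ ≤ _ := by
        have h1 := mul_nonneg ht1.le ha
        have h2 := mul_le_of_le_one_left (inv_nonneg.2 hd.le) hw2
        have h3 := mul_le_of_le_one_left
          (Real.rpow_nonneg ht1.le (-((n + 2 : ℝ) / (n + 1)))) hw3
        linarith

section Rays

variable {n : ℕ} {Ω : Set (E n)} {u : E n → ℝ}

lemma continuousOn_det_hessCLM (hu : ∀ x ∈ Ω, ContDiffAt ℝ 2 u x) :
    ContinuousOn (fun x => (hessCLM u x).det) Ω := by
  intro x hx
  have h1 : ContinuousAt (fderiv ℝ (fderiv ℝ u)) x :=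
    (((hu x hx).fderiv_right (m := 1) (by norm_num)).fderiv_right (m := 0)
      (by norm_num)).continuousAt
  have h2 : ContinuousAt (hessCLM u) x := continuousAt_const.clm_comp h1
  exact (ContinuousLinearMap.continuous_det.continuousAt.comp h2).continuousWithinAt

/-- In every ball of gradients there is one from which the ray in direction `ν` meets the gradient
image of a bounded set `V` in a set on which `1 / det D²u` is integrable. -/
lemma exists_lintegral_inv_det_lt_top (hΩc : Convex ℝ Ω) (hu : ∀ x ∈ Ω, ContDiffAt ℝ 2 u x)
    (hconv : ∀ x ∈ Ω, (Hess u x).PosDef) {e : OpenPartialHomeomorph (E n) (E n)}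
    (he : e.source = Ω) (he' : ⇑e = gradMap u) {V : Set (E n)} (hVo : IsOpen V) (hVΩ : V ⊆ Ω)
    (hV : volume V ≠ ⊤) {ν : E n} (hν : ‖ν‖ = 1) (y₀ : E n) {r : ℝ} (hr : 0 < r) :
    ∃ J : E n → ENNReal, Measurable J ∧
      (∀ x ∈ V, J (gradMap u x) = ENNReal.ofReal (hessCLM u x).det⁻¹) ∧
      ∃ y ∈ Metric.ball y₀ r, ∫⁻ t : ℝ, J (y + t • ν) ≠ ⊤ := by
  classical
  set S := e '' V with hS
  have hSo : IsOpen S := e.isOpen_image_of_subset_source hVo (he ▸ hVΩ)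
  set f : E n → ENNReal := fun z => ENNReal.ofReal (hessCLM u (e.symm z)).det⁻¹ with hf
  have hsymm : ∀ x ∈ V, e.symm (e x) = x := fun x hx => e.left_inv (he ▸ hVΩ hx)
  have hfc : ContinuousOn f S := by
    refine ENNReal.continuous_ofReal.comp_continuousOn (ContinuousOn.inv₀ ?_ ?_)
    · refine (continuousOn_det_hessCLM hu).comp (e.continuousOn_symm.mono ?_) ?_
      · rintro _ ⟨x, hx, rfl⟩
        exact e.map_source (he ▸ hVΩ hx)
      · rintro _ ⟨x, hx, rfl⟩
        rw [hsymm x hx]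
        exact hVΩ hx
    · rintro _ ⟨x, hx, rfl⟩
      rw [hsymm x hx]
      exact (hessCLM_det_pos (hconv x (hVΩ hx))).ne'
  set J : E n → ENNReal := S.piecewise f 0 with hJ
  have hJm : Measurable J := hfc.measurable_piecewise continuousOn_const hSo.measurableSet
  have hJV : ∀ x ∈ V, J (gradMap u x) = ENNReal.ofReal (hessCLM u x).det⁻¹ := by
    intro x hx
    rw [← he', hJ, piecewise_eq_of_mem _ _ _ (mem_image_of_mem e hx)]
    simp only [hf]
    rw [hsymm x hx]
  have hJint : ∫⁻ z, J z = volume V := by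
    calc ∫⁻ z, J z = ∫⁻ z in S, J z := by
          rw [← lintegral_indicator hSo.measurableSet]
          congr 1
          ext z
          by_cases hz : z ∈ S <;> simp [hJ, hz]
      _ = ∫⁻ x in V, ENNReal.ofReal |(hessCLM u x).det| * J (gradMap u x) := by
          rw [hS, he']
          exact lintegral_image_eq_lintegral_abs_det_fderiv_mul volume hVo.measurableSet
            (fun x hx => (hasFDerivAt_gradMap (hu x (hVΩ hx))).hasFDerivWithinAt)
            ((injOn_gradMap hΩc hu hconv).mono hVΩ) J
      _ = ∫⁻ x in V, 1 := by
          refine setLIntegral_congr_fun hVo.measurableSet fun x hx => ?_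
          have hpos := hessCLM_det_pos (hconv x (hVΩ hx))
          simp only [hJV x hx]
          rw [← ENNReal.ofReal_mul (abs_nonneg _), abs_of_pos hpos, mul_inv_cancel₀ hpos.ne',
            ENNReal.ofReal_one]
      _ = volume V := by simp
  refine ⟨J, hJm, hJV, ?_⟩
  by_contra! hcon
  have h1 := lintegral_ball_lintegral_line_le hJm hν y₀ r
  rw [setLIntegral_congr_fun measurableSet_ball hcon, hJint, setLIntegral_const,
    ENNReal.top_mul (Metric.measure_ball_pos volume y₀ hr).ne', top_le_iff] at h1
  exact ENNReal.mul_ne_top ENNReal.ofReal_ne_top hV h1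

/-- The preimage under `Du` of a ray of gradients. -/
def gradRay (e : OpenPartialHomeomorph (E n) (E n)) (y ν : E n) (κ τ : ℝ) : E n :=
  e.symm (y + rayTime κ τ • ν)

variable {e : OpenPartialHomeomorph (E n) (E n)} {y ν : E n} {κ : ℝ}

lemma gradMap_gradRay (he' : ⇑e = gradMap u)
    {τ : ℝ} (h : y + rayTime κ τ • ν ∈ e.target) :
    gradMap u (gradRay e y ν κ τ) = y + rayTime κ τ • ν := by
  rw [← he']
  exact e.right_inv h

lemma exists_hasDerivAt_gradRay (hu : ∀ x ∈ Ω, ContDiffAt ℝ 2 u x)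
    (hconv : ∀ x ∈ Ω, (Hess u x).PosDef) (he : e.source = Ω) (he' : ⇑e = gradMap u)
    (hκ : 0 ≤ κ) {τ : ℝ} (hτ : τ ∈ Ico (0 : ℝ) 1) (h : y + rayTime κ τ • ν ∈ e.target) :
    ContDiffAt ℝ 1 (gradRay e y ν κ) τ ∧ ∃ w,
      hessCLM u (gradRay e y ν κ τ) w = ν ∧
      HasDerivAt (gradRay e y ν κ) ((1 / (1 - τ + κ * τ) ^ 2) • w) τ := by
  have hx : gradRay e y ν κ τ ∈ Ω := he ▸ e.map_target h
  have hdet := (hessCLM_det_pos (hconv _ hx)).ne'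
  set H := (hessCLM u (gradRay e y ν κ τ)).toContinuousLinearEquivOfDetNeZero hdet with hH
  have hHe : HasFDerivAt e (H : E n →L[ℝ] E n) (e.symm (y + rayTime κ τ • ν)) := by
    rw [he', hH, ContinuousLinearMap.coe_toContinuousLinearEquivOfDetNeZero]
    exact hasFDerivAt_gradMap (hu _ hx)
  have hden := (rayTime_den_pos hκ hτ).ne'
  refine ⟨?_, H.symm ν, ?_, ?_⟩
  · have h1 : ContDiffAt ℝ 1 e.symm (y + rayTime κ τ • ν) :=
      e.contDiffAt_symm h hHe (he' ▸ contDiffAt_gradMap (hu _ hx))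
    exact h1.comp τ (contDiffAt_const.add ((contDiffAt_rayTime hden).smul contDiffAt_const))
  · exact H.apply_symm_apply ν
  · have h2 := (e.hasFDerivAt_symm h hHe).comp_hasDerivAt τ
      (((hasDerivAt_rayTime hden).smul_const ν).const_add y)
    rw [← H.symm.map_smul]
    exact h2

lemma isDivergentCurve_gradRay (hu : ∀ x ∈ Ω, ContDiffAt ℝ 2 u x)
    (hconv : ∀ x ∈ Ω, (Hess u x).PosDef) (he : e.source = Ω) (he' : ⇑e = gradMap u) (hκ : 0 ≤ κ)
    (hmem : ∀ τ ∈ Ico (0 : ℝ) 1, y + rayTime κ τ • ν ∈ e.target)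
    (hdiv : ∀ K ⊆ e.target, IsCompact K →
      ∃ t₀ ∈ Ico (0 : ℝ) 1, ∀ τ, t₀ < τ → τ < 1 → y + rayTime κ τ • ν ∉ K) :
    IsDivergentCurve Ω (gradRay e y ν κ) := by
  refine ⟨fun τ hτ => (exists_hasDerivAt_gradRay hu hconv he he' hκ hτ
    (hmem τ hτ)).1.contDiffWithinAt, fun τ hτ => he ▸ e.map_target (hmem τ hτ),
    fun K hK hKc => ?_⟩
  obtain ⟨t₀, ht₀, h⟩ := hdiv (e '' K)
    (by rintro _ ⟨x, hx, rfl⟩; exact e.map_source (he ▸ hK hx))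
    (hKc.image_of_continuousOn (e.continuousOn.mono (he ▸ hK)))
  exact ⟨t₀, ht₀, fun τ h1 h2 h3 => h τ h1 h2
    ⟨_, h3, e.right_inv (hmem τ ⟨ht₀.1.trans h1.le, h2⟩)⟩⟩

/-- A ray of gradients along which the points `x` and the values `u x` stay bounded, and along which
`1 / det D²u` is integrable, has finite affine length. -/
lemma lintegral_affine_gradRay_ne_top (hu : ∀ x ∈ Ω, ContDiffAt ℝ 2 u x)
    (hconv : ∀ x ∈ Ω, (Hess u x).PosDef) (he : e.source = Ω) (he' : ⇑e = gradMap u) (hκ : 0 ≤ κ)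
    (hν : ν ≠ 0) (hmem : ∀ τ ∈ Ico (0 : ℝ) 1, y + rayTime κ τ • ν ∈ e.target) {R B : ℝ}
    (hR : ∀ τ ∈ Ico (0 : ℝ) 1, ‖gradRay e y ν κ τ‖ ≤ R)
    (hB : ∀ τ ∈ Ico (0 : ℝ) 1, |u (gradRay e y ν κ τ)| ≤ B)
    {J : E n → ENNReal} (hJm : Measurable J)
    (hJ : ∀ τ ∈ Ico (0 : ℝ) 1, J (y + rayTime κ τ • ν) =
      ENNReal.ofReal (hessCLM u (gradRay e y ν κ τ)).det⁻¹)
    (hJint : ∫⁻ t : ℝ, J (y + t • ν) ≠ ⊤) :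
    ∫⁻ t in Set.Ico (0 : ℝ) 1, ENNReal.ofReal
      ((Hess u (gradRay e y ν κ t)).det ^ (-(1 : ℝ) / (2 * (n + 2))) *
        Real.sqrt (∑ i, ∑ j, Hess u (gradRay e y ν κ t) i j *
          curveDeriv (gradRay e y ν κ) t i * curveDeriv (gradRay e y ν κ) t j)) ≠ ⊤ := by
  set γ := gradRay e y ν κ with hγ
  have hγΩ : ∀ τ ∈ Ico (0 : ℝ) 1, γ τ ∈ Ω := fun τ hτ => he ▸ e.map_target (hmem τ hτ)
  have hderiv : ∀ τ, ∃ w, τ ∈ Ico (0 : ℝ) 1 → hessCLM u (γ τ) w = ν ∧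
      HasDerivAt γ ((1 / (1 - τ + κ * τ) ^ 2) • w) τ := fun τ => by
    by_cases hτ : τ ∈ Ico (0 : ℝ) 1
    · obtain ⟨w, hw⟩ := (exists_hasDerivAt_gradRay hu hconv he he' hκ hτ (hmem τ hτ)).2
      exact ⟨w, fun _ => hw⟩
    · exact ⟨0, fun h => absurd h hτ⟩
  choose w hw using hderiv
  set φ' : ℝ → ℝ := fun τ => 1 / (1 - τ + κ * τ) ^ 2 with hφ'
  have hφ'pos : ∀ τ ∈ Ico (0 : ℝ) 1, 0 < φ' τ := fun τ hτ =>
    one_div_pos.2 (pow_pos (rayTime_den_pos hκ hτ) 2)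
  set a : ℝ → ℝ := fun τ => inner ℝ ν (w τ) with ha
  have hapos : ∀ τ ∈ Ico (0 : ℝ) 1, 0 < a τ := fun τ hτ => by
    have hw0 : w τ ≠ 0 := fun h => hν (by rw [← (hw τ hτ).1, h, map_zero])
    simpa only [(hw τ hτ).1] using inner_hessCLM_pos (hconv _ (hγΩ τ hτ)) hw0
  set q : ℝ := (n + 2 : ℝ) / (n + 1) with hq
  set h : ℝ → ENNReal := fun t => J (y + t • ν) + ENNReal.ofReal ((1 + t) ^ (-q)) with hh
  set F' : ℝ → ℝ := fun τ => φ' τ * ((1 + rayTime κ τ) * a τ) with hF'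
  have hF'pos : ∀ τ ∈ Ico (0 : ℝ) 1, 0 < F' τ := fun τ hτ =>
    mul_pos (hφ'pos τ hτ) (mul_pos (by linarith [rayTime_nonneg hκ hτ]) (hapos τ hτ))
  set F : ℝ → ℝ := fun τ => u (γ τ) - inner ℝ (y - ν) (γ τ) with hF
  have hFd : ∀ τ ∈ Ico (0 : ℝ) 1, HasDerivAt F (F' τ) τ := fun τ hτ => by
    obtain ⟨-, hw2⟩ := hw τ hτ
    have h1 := (((hu _ (hγΩ τ hτ)).differentiableAt
      (by norm_num)).hasFDerivAt.comp_hasDerivAt τ hw2).sub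
      ((hasDerivAt_const τ (y - ν)).inner ℝ hw2)
    refine h1.congr_deriv ?_
    rw [← inner_gradMap, gradMap_gradRay he' (hmem τ hτ)]
    simp only [hF', hφ', ha, inner_add_left, inner_sub_left, inner_smul_left, inner_smul_right,
      inner_zero_left, conj_trivial]
    ring
  have hpoint : ∀ τ ∈ Ico (0 : ℝ) 1, ENNReal.ofReal
      ((Hess u (γ τ)).det ^ (-(1 : ℝ) / (2 * (n + 2))) *
        Real.sqrt (∑ i, ∑ j, Hess u (γ τ) i j * curveDeriv γ τ i * curveDeriv γ τ j)) ≤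
      ENNReal.ofReal |F' τ| + ENNReal.ofReal |φ' τ| * h (rayTime κ τ) := fun τ hτ => by
    obtain ⟨hw1, hw2⟩ := hw τ hτ
    have hφτ := hφ'pos τ hτ
    have hdet := hessCLM_det_pos (hconv _ (hγΩ τ hτ))
    have ht := rayTime_nonneg hκ hτ
    have hcd : curveDeriv γ τ = φ' τ • w τ :=
      hw2.hasDerivWithinAt.derivWithin (uniqueDiffOn_Ico 0 1 τ hτ)
    have hsum : inner ℝ (hessCLM u (γ τ) (φ' τ • w τ)) (φ' τ • w τ) = φ' τ ^ 2 * a τ := by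
      rw [map_smul, hw1, real_inner_smul_left, real_inner_smul_right, sq, mul_assoc]
    rw [sum_Hess_mul_mul, hcd, hsum, Real.sqrt_mul (sq_nonneg _), Real.sqrt_sq hφτ.le,
      abs_of_pos (hF'pos τ hτ), abs_of_pos hφτ, hh]
    simp only
    rw [hJ τ hτ, ← ENNReal.ofReal_add (inv_nonneg.2 hdet.le) (Real.rpow_nonneg (by linarith) _),
      ← ENNReal.ofReal_mul hφτ.le, ← ENNReal.ofReal_add (hF'pos τ hτ).le (mul_nonneg hφτ.le
        (add_nonneg (inv_nonneg.2 hdet.le) (Real.rpow_nonneg (by linarith) _))),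
      ← det_hessCLM]
    refine ENNReal.ofReal_le_ofReal ?_
    have := mul_le_mul_of_nonneg_left (rpow_mul_sqrt_le n (hapos τ hτ).le hdet ht) hφτ.le
    simp only [hF', hq]
    linarith
  have hhm : Measurable h := by fun_prop
  have hmeas : Measurable fun τ => ENNReal.ofReal |φ' τ| * h (rayTime κ τ) := by
    have h1 : Measurable (rayTime κ) := by unfold rayTime; fun_prop
    have h2 : Measurable φ' := by fun_prop
    exact (h2.abs.ennreal_ofReal).mul (hhm.comp h1)
  refine ne_top_of_le_ne_top ?_ (setLIntegral_mono' measurableSet_Ico hpoint)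
  rw [lintegral_add_right _ hmeas, ENNReal.add_ne_top]
  constructor
  · have hinj : InjOn F (Ico 0 1) := (strictMonoOn_of_deriv_pos (convex_Ico 0 1)
      (fun τ hτ => (hFd τ hτ).continuousAt.continuousWithinAt) fun τ hτ => by
        have hτ' := interior_subset hτ
        rw [(hFd τ hτ').deriv]
        exact hF'pos τ hτ').injOn
    have himg := lintegral_image_eq_lintegral_abs_deriv_mul measurableSet_Ico
      (fun τ hτ => (hFd τ hτ).hasDerivWithinAt) hinj 1
    simp only [Pi.one_apply, mul_one, lintegral_const, Measure.restrict_apply_univ, one_mul]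
      at himg
    rw [← himg]
    refine ne_top_of_le_ne_top (measure_closedBall_lt_top (x := (0 : ℝ))
      (r := B + ‖y - ν‖ * R)).ne (measure_mono ?_)
    rintro _ ⟨τ, hτ, rfl⟩
    rw [mem_closedBall_zero_iff]
    refine (norm_sub_le _ _).trans (add_le_add (hB τ hτ) ((norm_inner_le_norm _ _).trans ?_))
    exact mul_le_mul_of_nonneg_left (hR τ hτ) (norm_nonneg _)
  · rw [← lintegral_image_eq_lintegral_abs_deriv_mul measurableSet_Ico
      (fun τ hτ => (hasDerivAt_rayTime (rayTime_den_pos hκ hτ).ne').hasDerivWithinAt)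
      (injOn_rayTime hκ) h]
    have hsub : rayTime κ '' Ico 0 1 ⊆ Ioi (-(1 / 2)) := by
      rintro _ ⟨τ, hτ, rfl⟩
      have := rayTime_nonneg hκ hτ
      simp only [mem_Ioi]
      linarith
    refine ne_top_of_le_ne_top ?_ (lintegral_mono_set hsub)
    rw [lintegral_add_left (by fun_prop), ENNReal.add_ne_top]
    refine ⟨ne_top_of_le_ne_top hJint (setLIntegral_le_lintegral _ _), ?_⟩
    have hq1 : -q < -1 := by
      rw [hq, neg_lt_neg_iff, one_lt_div (by positivity)]
      linarith
    have hint := integrableOn_add_rpow_Ioi_of_lt (c := -(1 / 2)) (m := 1) hq1 (by norm_num)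
    simp only [add_comm _ (1 : ℝ)] at hint
    exact hint.lintegral_lt_top.ne

end Rays

/-- An open convex set has a unit outer normal at every point outside it. -/
lemma exists_unit_outer_normal {n : ℕ} {Ω : Set (E n)} (hΩo : IsOpen Ω)
    (hΩc : Convex ℝ Ω) (hne : Ω.Nonempty) {x₀ : E n} (hx₀ : x₀ ∉ Ω) :
    ∃ ν : E n, ‖ν‖ = 1 ∧ ∀ x ∈ Ω, 0 ≤ inner ℝ ν (x₀ - x) := by
  obtain ⟨f, hf⟩ := geometric_hahn_banach_open_point hΩc hΩo hx₀
  obtain ⟨p, hp⟩ := hne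
  set v := rieszCLM n f
  have hv : ∀ x ∈ Ω, 0 < inner ℝ v (x₀ - x) := fun x hx => by
    rw [inner_rieszCLM, map_sub]
    exact sub_pos.2 (hf x hx)
  have hv0 : v ≠ 0 := fun h => by simpa [h] using hv p hp
  refine ⟨‖v‖⁻¹ • v, by simp [norm_smul, hv0], fun x hx => ?_⟩
  rw [real_inner_smul_left]
  exact mul_nonneg (by positivity) (hv x hx).le

end AuxiliaryLemmas

/-- **Theorem 3.2 (graph version):** an affine complete, locally uniformly convex graph of
dimension `n ≥ 2` is Euclidean complete. -/
theorem affine_complete_implies_euclidean_complete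
    (n : ℕ) (hn : 2 ≤ n)
    (Ω : Set (E n)) (hΩo : IsOpen Ω) (hΩc : Convex ℝ Ω)
    (u : E n → ℝ) (hu : ContDiffOn ℝ (⊤ : ℕ∞) u Ω)
    (hconv : ∀ x ∈ Ω, (Hess u x).PosDef)
    (hac : AffineComplete Ω u) :
    EuclideanComplete Ω u := by
  have hu2 : ∀ x ∈ Ω, ContDiffAt ℝ 2 u x := fun x hx =>
    (hu.contDiffAt (hΩo.mem_nhds hx)).of_le (WithTop.coe_le_coe.2 (le_top : (2 : ℕ∞) ≤ ⊤))
  intro γ hγ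
  by_contra hfin
  obtain ⟨x₀, hx₀, L, hL⟩ := exists_boundary_point hΩo hΩc hu2 hconv hγ hfin
  have hp : γ 0 ∈ Ω := hγ.2.1 0 ⟨le_rfl, zero_lt_one⟩
  obtain ⟨ν, hν, hνΩ⟩ := exists_unit_outer_normal hΩo hΩc ⟨_, hp⟩ hx₀
  obtain ⟨r, hr, R, B, hball, hbd⟩ := exists_bounded_tube hΩo hΩc hu2 hconv hp hL hνΩ
  obtain ⟨e, he, he'⟩ := exists_openPartialHomeomorph_gradMap hΩo hΩc hu2 hconv
  have htarget : e.target = gradMap u '' Ω := by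
    rw [← e.image_source_eq_target, he, he']
  obtain ⟨J, hJm, hJ, y, hy, hJy⟩ := exists_lintegral_inv_det_lt_top hΩc hu2 hconv he he'
    (hΩo.inter Metric.isOpen_ball) Set.inter_subset_left
    (ne_top_of_le_ne_top (measure_ball_lt_top (x := (0 : E n)) (r := R + 1)).ne
      (measure_mono Set.inter_subset_right)) hν (gradMap u (γ 0)) hr
  obtain ⟨κ, hκ, hmem, hdiv⟩ := exists_rayTime_mem_and_divergent e.open_target
    (htarget ▸ hball hy) hν
  have hΩmem : ∀ τ ∈ Set.Ico (0 : ℝ) 1, gradRay e y ν κ τ ∈ Ω := fun τ hτ =>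
    he ▸ e.map_target (hmem τ hτ)
  have hbd' : ∀ τ ∈ Set.Ico (0 : ℝ) 1,
      ‖gradRay e y ν κ τ‖ ≤ R ∧ |u (gradRay e y ν κ τ)| ≤ B := fun τ hτ =>
    hbd _ (hΩmem τ hτ) y hy _ (rayTime_nonneg hκ hτ) (gradMap_gradRay he' (hmem τ hτ))
  refine lintegral_affine_gradRay_ne_top hu2 hconv he he' hκ
    (norm_ne_zero_iff.1 (hν ▸ one_ne_zero)) hmem (fun τ hτ => (hbd' τ hτ).1)
    (fun τ hτ => (hbd' τ hτ).2) hJm (fun τ hτ => ?_) hJy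
    (hac _ (isDivergentCurve_gradRay hu2 hconv he he' hκ hmem hdiv))
  rw [← gradMap_gradRay he' (hmem τ hτ)]
  refine hJ _ ⟨hΩmem τ hτ, ?_⟩
  rw [mem_ball_zero_iff]
  linarith [(hbd' τ hτ).1]

end
end
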